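/- arXiv:2211.07633 — 7 statements merged into one kernel-verified Lean document; each statement's English description precedes it below -/
import Mathlib

section
/- Let m₁, m₂ > 0 and let s be real with (m₁−m₂)² < s < (m₁+m₂)². Then ∫₀¹ (−iπ)/(s·α·(1−α) − m₁²·α − m₂²·(1−α)) dα = (−2π/√(((m₁+m₂)²−s)·(s−(m₁−m₂)²))) · Log( (√((m₁+m₂)²−s) − i·√(s−(m₁−m₂)²)) / (√((m₁+m₂)²−s) + i·√(s−(m₁−m₂)²)) ), where the square roots are the nonnegative real square roots and Log is the principal branch of the complex logarithm. -/
/-- The unit complex number with argument `-arctan (p / r)`, for `r ^ 2 + p ^ 2 = c ^ 2`. -/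
theorem exp_neg_arctan_div_mul_I {p r c : ℝ} (hr : 0 < r) (hc : 0 < c)
    (h : r ^ 2 + p ^ 2 = c ^ 2) :
    Complex.exp (-(Real.arctan (p / r) : ℂ) * Complex.I) = (r - Complex.I * p) / c := by
  have hsqrt : √(1 + (p / r) ^ 2) = c / r := by
    rw [show 1 + (p / r) ^ 2 = (c / r) ^ 2 by field_simp; linarith]
    exact Real.sqrt_sq (by positivity)
  have hcos : Real.cos (Real.arctan (p / r)) = r / c := by
    rw [Real.cos_arctan, hsqrt, one_div_div]
  have hsin : Real.sin (Real.arctan (p / r)) = p / c := by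
    rw [Real.sin_arctan, hsqrt]
    field_simp
  rw [Complex.exp_mul_I, Complex.cos_neg, Complex.sin_neg, ← Complex.ofReal_cos,
    ← Complex.ofReal_sin, hcos, hsin]
  push_cast
  ring

/-- The integral of the reciprocal of a quadratic with negative discriminant `-r ^ 2`. -/
theorem integral_inv_quadratic {a b c r : ℝ} (hr : 0 < r) (ha : 0 < a)
    (h : 4 * a * c - b ^ 2 = r ^ 2) (x y : ℝ) :
    ∫ t in x..y, (a * t ^ 2 + b * t + c)⁻¹ =
      2 / r * (Real.arctan ((2 * a * y + b) / r) - Real.arctan ((2 * a * x + b) / r)) := by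
  have hpos (t : ℝ) : 0 < a * t ^ 2 + b * t + c := by
    have : 0 < 4 * a * (a * t ^ 2 + b * t + c) := by
      nlinarith [sq_nonneg (2 * a * t + b), pow_pos hr 2]
    exact pos_of_mul_pos_right this (by positivity)
  have hderiv (t : ℝ) : HasDerivAt (fun t ↦ 2 / r * Real.arctan ((2 * a * t + b) / r))
      (a * t ^ 2 + b * t + c)⁻¹ t := by
    have hlin : HasDerivAt (fun t ↦ (2 * a * t + b) / r) (2 * a * 1 / r) t :=
      (((hasDerivAt_id t).const_mul (2 * a)).add_const b).div_const r
    refine (hlin.arctan.const_mul (2 / r)).congr_deriv ?_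
    have hq : 1 + ((2 * a * t + b) / r) ^ 2 = 4 * a * (a * t ^ 2 + b * t + c) / r ^ 2 := by
      field_simp
      linear_combination -h
    have := (hpos t).ne'
    rw [hq]
    field_simp
    norm_num
  rw [intervalIntegral.integral_eq_sub_of_hasDerivAt (fun t _ ↦ hderiv t)]
  · ring
  · exact (Continuous.inv₀ (by fun_prop) fun t ↦ (hpos t).ne').intervalIntegrable _ _

/-- The logarithm of the ratio of conjugates as a sum of the two arctangents, where `u ^ 2` and
`v ^ 2` are the distances of `s` to the normal threshold and to the pseudothreshold. -/
theorem log_threshold_ratio {m₁ m₂ s u v : ℝ} (hm₁ : 0 < m₁) (hm₂ : 0 < m₂) (hs : 0 < s)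
    (hu : 0 < u) (hv : 0 < v) (hu2 : u ^ 2 = (m₁ + m₂) ^ 2 - s)
    (hv2 : v ^ 2 = s - (m₁ - m₂) ^ 2) :
    Complex.log (((u : ℂ) - Complex.I * v) / (u + Complex.I * v)) =
      -((Real.arctan ((s + m₁ ^ 2 - m₂ ^ 2) / (u * v)) +
        Real.arctan ((s - m₁ ^ 2 + m₂ ^ 2) / (u * v)) : ℝ) : ℂ) * Complex.I := by
  set x := (s + m₁ ^ 2 - m₂ ^ 2) / (u * v) with hx
  set y := (s - m₁ ^ 2 + m₂ ^ 2) / (u * v) with hy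
  have hσ : √s ^ 2 = s := Real.sq_sqrt hs.le
  have hden : (u : ℂ) + Complex.I * v ≠ 0 := fun h ↦ by
    have := congrArg Complex.re h
    simp at this
    exact hu.ne' this
  have hexp : Complex.exp (-((Real.arctan x + Real.arctan y : ℝ) : ℂ) * Complex.I) =
      ((u : ℂ) - Complex.I * v) / (u + Complex.I * v) := by
    rw [Complex.ofReal_add, neg_add, add_mul, Complex.exp_add, hx, hy,
      exp_neg_arctan_div_mul_I (c := 2 * √s * m₁) (by positivity) (by positivity)
        (by rw [mul_pow, mul_pow, mul_pow, hσ, hu2, hv2]; ring),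
      exp_neg_arctan_div_mul_I (c := 2 * √s * m₂) (by positivity) (by positivity)
        (by rw [mul_pow, mul_pow, mul_pow, hσ, hu2, hv2]; ring),
      div_mul_div_comm, div_eq_div_iff _ hden]
    · have hσ' : ((√s : ℝ) : ℂ) ^ 2 = s := by exact_mod_cast hσ
      rw [show (u - Complex.I * v) * (((2 * √s * m₁ : ℝ) : ℂ) * ((2 * √s * m₂ : ℝ) : ℂ)) =
        (u - Complex.I * v) * (4 * s * m₁ * m₂) by push_cast; rw [← hσ']; ring]
      obtain rfl : s = v ^ 2 + (m₁ - m₂) ^ 2 := by linarith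
      have hu2' : (u : ℂ) ^ 2 = 4 * m₁ * m₂ - v ^ 2 := by
        exact_mod_cast (by linarith : u ^ 2 = 4 * m₁ * m₂ - v ^ 2)
      push_cast
      linear_combination
        (u * v ^ 2 + Complex.I * v * (v ^ 2 - 2 * (v ^ 2 + (m₁ - m₂) ^ 2))) * hu2' +
        ((((v : ℂ) ^ 2 + (m₁ - m₂) ^ 2) + m₁ ^ 2 - m₂ ^ 2) * (((v : ℂ) ^ 2 + (m₁ - m₂) ^ 2) - m₁ ^ 2 + m₂ ^ 2) *
          (u + Complex.I * v) - 2 * (v ^ 2 + (m₁ - m₂) ^ 2) * u * v ^ 2) * Complex.I_sq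
    · exact_mod_cast (by positivity : 2 * √s * m₁ * (2 * √s * m₂) ≠ 0)
  rw [← hexp, Complex.log_exp]
  · rw [← Complex.ofReal_neg, Complex.im_ofReal_mul, Complex.I_im, mul_one]
    linarith [Real.arctan_lt_pi_div_two x, Real.arctan_lt_pi_div_two y]
  · rw [← Complex.ofReal_neg, Complex.im_ofReal_mul, Complex.I_im, mul_one]
    linarith [Real.neg_pi_div_two_lt_arctan x, Real.neg_pi_div_two_lt_arctan y]

/-- The Feynman-parameter representation of the two-dimensional bubble integral,
evaluated between the pseudothreshold and the normal threshold. -/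
theorem bubble_integral_between_thresholds (m₁ m₂ : ℝ) (hm₁ : 0 < m₁) (hm₂ : 0 < m₂)
    (s : ℝ) (hs₁ : (m₁ - m₂) ^ 2 < s) (hs₂ : s < (m₁ + m₂) ^ 2) :
    (∫ α in (0 : ℝ)..(1 : ℝ),
        (-Complex.I * (Real.pi : ℂ)) /
          ((s : ℂ) * (α : ℂ) * (1 - (α : ℂ)) - (m₁ : ℂ) ^ 2 * (α : ℂ) -
            (m₂ : ℂ) ^ 2 * (1 - (α : ℂ)))) =
      ((-2 * Real.pi / Real.sqrt (((m₁ + m₂) ^ 2 - s) * (s - (m₁ - m₂) ^ 2)) : ℝ) : ℂ) *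
        Complex.log
          (((Real.sqrt ((m₁ + m₂) ^ 2 - s) : ℂ) -
              Complex.I * (Real.sqrt (s - (m₁ - m₂) ^ 2) : ℂ)) /
            ((Real.sqrt ((m₁ + m₂) ^ 2 - s) : ℂ) +
              Complex.I * (Real.sqrt (s - (m₁ - m₂) ^ 2) : ℂ))) := by
  have hA : 0 < (m₁ + m₂) ^ 2 - s := by linarith
  have hB : 0 < s - (m₁ - m₂) ^ 2 := by linarith
  have hs : 0 < s := (sq_nonneg _).trans_lt hs₁
  rw [log_threshold_ratio hm₁ hm₂ hs (Real.sqrt_pos.2 hA) (Real.sqrt_pos.2 hB)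
    (Real.sq_sqrt hA.le) (Real.sq_sqrt hB.le), ← Real.sqrt_mul hA.le]
  set r := √(((m₁ + m₂) ^ 2 - s) * (s - (m₁ - m₂) ^ 2)) with hr
  have hrpos : 0 < r := Real.sqrt_pos.2 (mul_pos hA hB)
  have hr2 : 4 * s * m₂ ^ 2 - (-(s - m₁ ^ 2 + m₂ ^ 2)) ^ 2 = r ^ 2 := by
    rw [hr, Real.sq_sqrt (mul_pos hA hB).le]
    ring
  have hint := integral_inv_quadratic hrpos hs hr2 0 1
  have hfun (t : ℝ) : (-Complex.I * (Real.pi : ℂ)) /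
      ((s : ℂ) * t * (1 - t) - (m₁ : ℂ) ^ 2 * t - (m₂ : ℂ) ^ 2 * (1 - t)) =
      Complex.I * Real.pi *
        (((s * t ^ 2 + -(s - m₁ ^ 2 + m₂ ^ 2) * t + m₂ ^ 2)⁻¹ : ℝ) : ℂ) := by
    rw [neg_mul, neg_div, ← div_neg, div_eq_mul_inv]
    push_cast
    ring_nf
  simp_rw [hfun]
  rw [intervalIntegral.integral_const_mul, intervalIntegral.integral_ofReal, hint,
    show 2 * s * 1 + -(s - m₁ ^ 2 + m₂ ^ 2) = s + m₁ ^ 2 - m₂ ^ 2 by ring,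
    show 2 * s * 0 + -(s - m₁ ^ 2 + m₂ ^ 2) = -(s - m₁ ^ 2 + m₂ ^ 2) by ring,
    neg_div, Real.arctan_neg]
  push_cast
  ring
end

section
/- Let m₁, m₂ > 0. For z ∈ ℂ with Im z ≠ 0, define F(z) = ∫₀¹ (−iπ)/(z·α·(1−α) − m₁²·α − m₂²·(1−α)) dα. Then for every real s > (m₁+m₂)², lim_{ε→0⁺} ( F(s+iε) − F(s−iε) ) = −4π² / √((s−(m₁−m₂)²)·(s−(m₁+m₂)²)). -/
/-- The Feynman-parameter representation of the two-dimensional bubble integral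
with complexified external invariant `z = p²`. -/
noncomputable def bubbleF (m₁ m₂ : ℝ) (z : ℂ) : ℂ :=
  ∫ α in (0 : ℝ)..(1 : ℝ),
    (-Complex.I * (Real.pi : ℂ)) /
      (z * (α : ℂ) * (1 - (α : ℂ)) - (m₁ : ℂ) ^ 2 * (α : ℂ) -
        (m₂ : ℂ) ^ 2 * (1 - (α : ℂ)))

open Filter Topology Complex

/-- The difference of principal logarithms evaluating `∫₀¹ dx / (x - c)`. -/
noncomputable def logPole (c : ℂ) : ℂ := log (1 - c) - log (-c)

lemma ofReal_sub_ne_zero {c : ℂ} (hc : c.im ≠ 0) (x : ℝ) : (x : ℂ) - c ≠ 0 := by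
  intro h
  apply hc
  rw [← sub_eq_zero.mp h, ofReal_im]

lemma intervalIntegrable_inv_ofReal_sub {c : ℂ} (hc : c.im ≠ 0) (u v : ℝ) :
    IntervalIntegrable (fun x : ℝ => ((x : ℂ) - c)⁻¹) MeasureTheory.volume u v :=
  ((by fun_prop : Continuous fun x : ℝ => (x : ℂ) - c).inv₀
    (ofReal_sub_ne_zero hc)).intervalIntegrable u v

lemma integral_inv_ofReal_sub {c : ℂ} (hc : c.im ≠ 0) :
    ∫ x in (0 : ℝ)..1, ((x : ℂ) - c)⁻¹ = logPole c := by
  have h : ∀ x ∈ Set.uIcc (0 : ℝ) 1,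
      HasDerivAt (fun x : ℝ => log ((x : ℂ) - c)) ((x : ℂ) - c)⁻¹ x := by
    intro x _
    have hx : (x : ℂ) - c ∈ slitPlane := by
      right
      simpa using hc
    have := (ofRealCLM.hasDerivAt (x := x)).sub_const c |>.clog_real (by simpa using hx)
    simpa using this
  rw [intervalIntegral.integral_eq_sub_of_hasDerivAt h
    (intervalIntegrable_inv_ofReal_sub hc 0 1)]
  simp [logPole]

lemma bubbleF_eq_logPole {m₁ m₂ : ℝ} {z a b : ℂ} (hz : z ≠ 0) (ha : a.im ≠ 0) (hb : b.im ≠ 0)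
    (hab : a ≠ b) (hsum : z * (a + b) = z + m₂ ^ 2 - m₁ ^ 2) (hprod : z * (a * b) = m₂ ^ 2) :
    bubbleF m₁ m₂ z = I * Real.pi / (z * (a - b)) * (logPole a - logPole b) := by
  rw [← integral_inv_ofReal_sub ha, ← integral_inv_ofReal_sub hb,
    ← intervalIntegral.integral_sub (intervalIntegrable_inv_ofReal_sub ha 0 1)
      (intervalIntegrable_inv_ofReal_sub hb 0 1), ← intervalIntegral.integral_const_mul]
  unfold bubbleF
  congr 1
  ext x
  have h1 := ofReal_sub_ne_zero ha x
  have h2 := ofReal_sub_ne_zero hb x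
  have h3 := sub_ne_zero.mpr hab
  have hD : z * (x : ℂ) * (1 - (x : ℂ)) - (m₁ : ℂ) ^ 2 * (x : ℂ) - (m₂ : ℂ) ^ 2 * (1 - (x : ℂ)) =
      -(z * ((x : ℂ) - a) * ((x : ℂ) - b)) := by
    linear_combination (-(x : ℂ)) * hsum + hprod
  rw [hD]
  field_simp
  ring

lemma bubbleF_conj (m₁ m₂ : ℝ) (z : ℂ) :
    bubbleF m₁ m₂ (starRingEnd ℂ z) = -starRingEnd ℂ (bubbleF m₁ m₂ z) := by
  unfold bubbleF
  rw [← intervalIntegral.intervalIntegral_conj, ← intervalIntegral.integral_neg]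
  congr 1
  ext x
  simp [neg_div]

lemma im_eq_of_root {m₁ m₂ : ℝ} {z r : ℂ} (h0 : r ≠ 0) (h1 : 1 - r ≠ 0)
    (h : z * r * (1 - r) = m₁ ^ 2 * r + m₂ ^ 2 * (1 - r)) :
    z.im = r.im * (m₁ ^ 2 / normSq (1 - r) - m₂ ^ 2 / normSq r) := by
  have hz : z = ((m₁ ^ 2 : ℝ) : ℂ) * (1 - r)⁻¹ + ((m₂ ^ 2 : ℝ) : ℂ) * r⁻¹ := by
    push_cast
    field_simp
    linear_combination h
  rw [hz]
  simp only [add_im, im_ofReal_mul, inv_im, sub_im, one_im]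
  ring

lemma tendsto_logPole_of_im_pos {ι : Type*} {l : Filter ι} {r : ι → ℂ} {x : ℝ} (hx0 : 0 < x)
    (hx1 : x < 1) (hr : Tendsto r l (𝓝 x)) (him : ∀ᶠ i in l, 0 < (r i).im) :
    Tendsto (fun i => logPole (r i)) l
      (𝓝 ((Real.log (1 - x) - Real.log x : ℝ) + Real.pi * I)) := by
  have h1 : Tendsto (fun i => log (1 - r i)) l (𝓝 (Real.log (1 - x) : ℝ)) := by
    have := (tendsto_const_nhds (x := (1 : ℂ))).sub hr |>.clog (Or.inl (by simpa using hx1))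
    rwa [← ofReal_one, ← ofReal_sub, ← ofReal_log (by linarith)] at this
  have h2 := (tendsto_log_nhdsWithin_im_neg_of_re_neg_of_im_zero (z := -(x : ℂ))
    (by simpa using hx0) (by simp)).comp
      (tendsto_nhdsWithin_iff.mpr ⟨hr.neg, him.mono fun i hi => by simpa using hi⟩)
  refine (h1.sub h2).congr' (Eventually.of_forall fun i => rfl) |>.trans (le_of_eq ?_)
  congr 1
  rw [norm_neg, norm_real, Real.norm_of_nonneg hx0.le]
  push_cast
  ring

lemma tendsto_logPole_of_im_neg {ι : Type*} {l : Filter ι} {r : ι → ℂ} {x : ℝ} (hx0 : 0 < x)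
    (hx1 : x < 1) (hr : Tendsto r l (𝓝 x)) (him : ∀ᶠ i in l, (r i).im < 0) :
    Tendsto (fun i => logPole (r i)) l
      (𝓝 ((Real.log (1 - x) - Real.log x : ℝ) - Real.pi * I)) := by
  have h1 : Tendsto (fun i => log (1 - r i)) l (𝓝 (Real.log (1 - x) : ℝ)) := by
    have := (tendsto_const_nhds (x := (1 : ℂ))).sub hr |>.clog (Or.inl (by simpa using hx1))
    rwa [← ofReal_one, ← ofReal_sub, ← ofReal_log (by linarith)] at this
  have h2 := (tendsto_log_nhdsWithin_im_nonneg_of_re_neg_of_im_zero (z := -(x : ℂ))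
    (by simpa using hx0) (by simp)).comp
      (tendsto_nhdsWithin_iff.mpr ⟨hr.neg, him.mono fun i hi => by simpa using hi.le⟩)
  refine (h1.sub h2).congr' (Eventually.of_forall fun i => rfl) |>.trans (le_of_eq ?_)
  congr 1
  rw [norm_neg, norm_real, Real.norm_of_nonneg hx0.le]
  push_cast
  ring

/-- Along roots of the bubble denominator at external invariants in the upper half plane, the
imaginary part eventually has the sign of `m₁ x - m₂ (1 - x)`, where `x` is the limiting root. -/
lemma eventually_im_mul_pos_of_root {m₁ m₂ : ℝ} (hm₁ : 0 < m₁) (hm₂ : 0 < m₂) {ι : Type*}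
    {l : Filter ι} {z r : ι → ℂ} {x : ℝ} (hx0 : 0 < x) (hx1 : x < 1)
    (hne : m₁ * x - m₂ * (1 - x) ≠ 0) (hr : Tendsto r l (𝓝 x)) (hz : ∀ᶠ i in l, 0 < (z i).im)
    (hroot : ∀ᶠ i in l, z i * r i * (1 - r i) = m₁ ^ 2 * r i + m₂ ^ 2 * (1 - r i)) :
    ∀ᶠ i in l, 0 < (r i).im * (m₁ * x - m₂ * (1 - x)) := by
  have hx0' : (x : ℂ) ≠ 0 := by exact_mod_cast hx0.ne'
  have hx1' : (1 : ℂ) - x ≠ 0 := by exact_mod_cast (sub_pos.mpr hx1).ne'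
  have hr1 : Tendsto (fun i => 1 - r i) l (𝓝 (1 - x)) := tendsto_const_nhds.sub hr
  have hlim : Tendsto (fun i => (m₁ ^ 2 / normSq (1 - r i) - m₂ ^ 2 / normSq (r i)) *
      (m₁ * x - m₂ * (1 - x))) l (𝓝 ((m₁ ^ 2 / normSq (1 - (x : ℂ)) - m₂ ^ 2 / normSq (x : ℂ)) *
      (m₁ * x - m₂ * (1 - x)))) :=
    ((tendsto_const_nhds.div ((continuous_normSq.tendsto _).comp hr1)
      (by simpa using hx1')).sub (tendsto_const_nhds.div ((continuous_normSq.tendsto _).comp hr)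
      (by simpa using hx0'))).mul_const _
  have hpos : 0 < (m₁ ^ 2 / normSq (1 - (x : ℂ)) - m₂ ^ 2 / normSq (x : ℂ)) *
      (m₁ * x - m₂ * (1 - x)) := by
    have hy : 0 < 1 - x := sub_pos.mpr hx1
    rw [← ofReal_one, ← ofReal_sub, normSq_ofReal, normSq_ofReal]
    have : (m₁ ^ 2 / ((1 - x) * (1 - x)) - m₂ ^ 2 / (x * x)) * (m₁ * x - m₂ * (1 - x)) =
        (m₁ * x - m₂ * (1 - x)) ^ 2 * ((m₁ * x + m₂ * (1 - x)) / ((1 - x) * x) ^ 2) := by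
      field_simp
      ring
    rw [this]
    positivity
  filter_upwards [hlim.eventually_const_lt hpos, hz, hroot, hr.eventually_ne hx0',
    hr1.eventually_ne hx1'] with i h1 h2 h3 h4 h5
  rw [im_eq_of_root h4 h5 h3] at h2
  have h6 := mul_pos h2 h1
  set k := m₁ ^ 2 / normSq (1 - r i) - m₂ ^ 2 / normSq (r i)
  by_contra! h
  nlinarith [mul_nonneg (sq_nonneg k) (neg_nonneg.mpr h)]

lemma tendsto_bubbleF_above_threshold {m₁ m₂ : ℝ} (hm₁ : 0 < m₁) (hm₂ : 0 < m₂) {s : ℝ}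
    (hs : (m₁ + m₂) ^ 2 < s) {ι : Type*} {l : Filter ι} {z : ι → ℂ}
    (hz : Tendsto z l (𝓝 s)) (hzim : ∀ᶠ i in l, 0 < (z i).im) :
    ∃ y : ℝ, Tendsto (fun i => bubbleF m₁ m₂ (z i)) l
      (𝓝 ((-2 * Real.pi ^ 2 / Real.sqrt ((s - (m₁ - m₂) ^ 2) * (s - (m₁ + m₂) ^ 2)) : ℝ) +
        y * I)) := by
  have ht : 0 < s - (m₁ + m₂) ^ 2 := sub_pos.mpr hs
  have hmm : 0 < m₁ * m₂ := mul_pos hm₁ hm₂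
  have hs0 : 0 < s := by nlinarith [sq_nonneg (m₁ + m₂)]
  have ht' : 0 < s - (m₁ - m₂) ^ 2 := by nlinarith
  have hdisc : 0 < (s - (m₁ - m₂) ^ 2) * (s - (m₁ + m₂) ^ 2) := mul_pos ht' ht
  set W := Real.sqrt ((s - (m₁ - m₂) ^ 2) * (s - (m₁ + m₂) ^ 2)) with hW
  have hWpos : 0 < W := Real.sqrt_pos.mpr hdisc
  have hWsq : W ^ 2 = (s - (m₁ - m₂) ^ 2) * (s - (m₁ + m₂) ^ 2) := Real.sq_sqrt hdisc.le
  set w : ι → ℂ := fun i => ((z i - (m₁ - m₂) ^ 2) * (z i - (m₁ + m₂) ^ 2)) ^ (2⁻¹ : ℂ) with hw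
  have hwsq : ∀ i, w i ^ 2 = (z i - (m₁ - m₂) ^ 2) * (z i - (m₁ + m₂) ^ 2) := fun i =>
    cpow_ofNat_inv_pow _ 2
  have hwlim : Tendsto w l (𝓝 W) := by
    have hcast : ((s : ℂ) - (m₁ - m₂) ^ 2) * (s - (m₁ + m₂) ^ 2) =
        (((s - (m₁ - m₂) ^ 2) * (s - (m₁ + m₂) ^ 2) : ℝ) : ℂ) := by push_cast; rfl
    have h := ((hz.sub_const (((m₁ : ℂ) - m₂) ^ 2)).mul (hz.sub_const (((m₁ : ℂ) + m₂) ^ 2)))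
    rw [hcast] at h
    have h2 := (continuousAt_cpow_const (b := (2⁻¹ : ℂ))
      (ofReal_mem_slitPlane.mpr hdisc)).tendsto.comp h
    have h3 : ((((s - (m₁ - m₂) ^ 2) * (s - (m₁ + m₂) ^ 2) : ℝ) : ℂ)) ^ (2⁻¹ : ℂ) = W := by
      rw [hW, Real.sqrt_eq_rpow, ofReal_cpow hdisc.le]
      norm_num
    rwa [h3] at h2
  have hs0' : (s : ℂ) ≠ 0 := by exact_mod_cast hs0.ne'
  have hz2 : Tendsto (fun i => 2 * z i) l (𝓝 (2 * s)) := hz.const_mul 2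
  have hnum : Tendsto (fun i => z i + m₂ ^ 2 - m₁ ^ 2) l (𝓝 (s + m₂ ^ 2 - m₁ ^ 2)) :=
    (hz.add_const _).sub_const _
  set a : ι → ℂ := fun i => (z i + m₂ ^ 2 - m₁ ^ 2 + w i) / (2 * z i) with ha
  set b : ι → ℂ := fun i => (z i + m₂ ^ 2 - m₁ ^ 2 - w i) / (2 * z i) with hb
  set a₀ : ℝ := (s + m₂ ^ 2 - m₁ ^ 2 + W) / (2 * s) with ha₀
  set b₀ : ℝ := (s + m₂ ^ 2 - m₁ ^ 2 - W) / (2 * s) with hb₀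
  have halim : Tendsto a l (𝓝 a₀) := by
    have := (hnum.add hwlim).div hz2 (by simpa using hs0')
    rw [ha₀]
    push_cast
    exact this
  have hblim : Tendsto b l (𝓝 b₀) := by
    have := (hnum.sub hwlim).div hz2 (by simpa using hs0')
    rw [hb₀]
    push_cast
    exact this
  have hWlt : W < s + m₂ ^ 2 - m₁ ^ 2 := by
    refine lt_of_pow_lt_pow_left₀ 2 (by nlinarith) ?_
    rw [hWsq]
    nlinarith [mul_pos hs0 (pow_pos hm₂ 2)]
  have hWlt' : W < s - m₂ ^ 2 + m₁ ^ 2 := by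
    refine lt_of_pow_lt_pow_left₀ 2 (by nlinarith) ?_
    rw [hWsq]
    nlinarith [mul_pos hs0 (pow_pos hm₁ 2)]
  have ha0 : 0 < a₀ := div_pos (by linarith) (by linarith)
  have hb0 : 0 < b₀ := div_pos (by linarith) (by linarith)
  have ha1 : a₀ < 1 := (div_lt_one (by linarith)).mpr (by linarith)
  have hb1 : b₀ < 1 := (div_lt_one (by linarith)).mpr (by linarith)
  have hsep : |(m₂ - m₁) * (s - (m₁ + m₂) ^ 2)| < (m₁ + m₂) * W := by
    refine abs_lt_of_sq_lt_sq ?_ (by positivity)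
    rw [mul_pow (m₁ + m₂) W, hWsq]
    have : 0 < (s - (m₁ + m₂) ^ 2) * (4 * (m₁ * m₂) * s) := by positivity
    linear_combination this
  obtain ⟨hsep1, hsep2⟩ := abs_lt.mp hsep
  have hma : 0 < m₁ * a₀ - m₂ * (1 - a₀) := by
    have : m₁ * a₀ - m₂ * (1 - a₀) =
        ((m₁ + m₂) * W - (m₂ - m₁) * (s - (m₁ + m₂) ^ 2)) / (2 * s) := by
      rw [ha₀]
      field_simp
      ring
    rw [this]
    exact div_pos (by linarith) (by linarith)
  have hmb : m₁ * b₀ - m₂ * (1 - b₀) < 0 := by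
    have : m₁ * b₀ - m₂ * (1 - b₀) =
        (-((m₁ + m₂) * W) - (m₂ - m₁) * (s - (m₁ + m₂) ^ 2)) / (2 * s) := by
      rw [hb₀]
      field_simp
      ring
    rw [this]
    exact div_neg_of_neg_of_pos (by linarith) (by linarith)
  have hzne : ∀ᶠ i in l, z i ≠ 0 := hz.eventually_ne hs0'
  have haim : ∀ᶠ i in l, 0 < (a i).im := by
    refine (eventually_im_mul_pos_of_root hm₁ hm₂ ha0 ha1 hma.ne' halim hzim ?_).mono
      fun i hi => pos_of_mul_pos_left hi hma.le
    filter_upwards [hzne] with i hi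
    simp only [ha]
    field_simp
    linear_combination (-1 : ℂ) * hwsq i
  have hbim : ∀ᶠ i in l, (b i).im < 0 := by
    refine (eventually_im_mul_pos_of_root hm₁ hm₂ hb0 hb1 hmb.ne hblim hzim ?_).mono
      fun i hi => neg_of_mul_pos_left hi hmb.le
    filter_upwards [hzne] with i hi
    simp only [hb]
    field_simp
    linear_combination (-1 : ℂ) * hwsq i
  have hWne : (W : ℂ) ≠ 0 := by exact_mod_cast hWpos.ne'
  have hmain := ((tendsto_const_nhds (x := I * (Real.pi : ℂ))).div hwlim hWne).mul
    ((tendsto_logPole_of_im_pos ha0 ha1 halim haim).sub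
      (tendsto_logPole_of_im_neg hb0 hb1 hblim hbim))
  refine ⟨Real.pi / W * ((Real.log (1 - a₀) - Real.log a₀) -
    (Real.log (1 - b₀) - Real.log b₀)), ?_⟩
  have hlim : I * (Real.pi : ℂ) / W * (((Real.log (1 - a₀) - Real.log a₀ : ℝ) + Real.pi * I) -
      ((Real.log (1 - b₀) - Real.log b₀ : ℝ) - Real.pi * I)) =
      ((-2 * Real.pi ^ 2 / W : ℝ) : ℂ) + ((Real.pi / W * ((Real.log (1 - a₀) - Real.log a₀) -
        (Real.log (1 - b₀) - Real.log b₀)) : ℝ) : ℂ) * I := by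
    push_cast
    field_simp
    linear_combination 2 * (Real.pi : ℂ) * I_sq
  rw [hlim] at hmain
  refine hmain.congr' ?_
  filter_upwards [hzne, haim, hbim] with i hi hai hbi
  have hw_eq : z i * (a i - b i) = w i := by
    simp only [ha, hb]
    field_simp
    ring
  have hab : a i ≠ b i := fun h => by
    have := congrArg im h
    linarith
  rw [bubbleF_eq_logPole hi hai.ne' hbi.ne hab, hw_eq]
  · rfl
  · simp only [ha, hb]
    field_simp
    ring
  · simp only [ha, hb]
    field_simp
    linear_combination (-1 : ℂ) * hwsq i

/-- Above the normal threshold the discontinuity of the bubble integral across the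
real axis equals Cutkosky's absorption integral. -/
theorem bubble_discontinuity_above_threshold (m₁ m₂ : ℝ) (hm₁ : 0 < m₁) (hm₂ : 0 < m₂)
    (s : ℝ) (hs : (m₁ + m₂) ^ 2 < s) :
    Filter.Tendsto
      (fun ε : ℝ =>
        bubbleF m₁ m₂ ((s : ℂ) + (ε : ℂ) * Complex.I) -
          bubbleF m₁ m₂ ((s : ℂ) - (ε : ℂ) * Complex.I))
      (nhdsWithin 0 (Set.Ioi 0))
      (nhds (((-4 * Real.pi ^ 2 /
          Real.sqrt ((s - (m₁ - m₂) ^ 2) * (s - (m₁ + m₂) ^ 2))) : ℝ) : ℂ)) := by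
  have hcont : Tendsto (fun ε : ℝ => (s : ℂ) + (ε : ℂ) * I) (𝓝[>] 0) (𝓝 s) := by
    have h : Continuous fun ε : ℝ => (s : ℂ) + (ε : ℂ) * I := by fun_prop
    simpa using (h.tendsto 0).mono_left nhdsWithin_le_nhds
  have him : ∀ᶠ ε : ℝ in 𝓝[>] 0, 0 < ((s : ℂ) + (ε : ℂ) * I).im := by
    filter_upwards [self_mem_nhdsWithin] with ε hε
    simpa using hε
  obtain ⟨y, hy⟩ := tendsto_bubbleF_above_threshold hm₁ hm₂ hs hcont him
  have h := hy.add ((continuous_conj.tendsto _).comp hy)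
  have hlim : ∀ x : ℝ, ((-2 * Real.pi ^ 2 / x : ℝ) : ℂ) + y * I +
      starRingEnd ℂ (((-2 * Real.pi ^ 2 / x : ℝ) : ℂ) + y * I) =
      ((-4 * Real.pi ^ 2 / x : ℝ) : ℂ) := by
    intro x
    rw [map_add, map_mul, conj_ofReal, conj_ofReal, conj_I]
    push_cast
    ring
  rw [hlim] at h
  refine h.congr fun ε => ?_
  have hconj : (s : ℂ) - (ε : ℂ) * I = starRingEnd ℂ ((s : ℂ) + (ε : ℂ) * I) := by
    rw [map_add, map_mul, conj_ofReal, conj_ofReal, conj_I]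
    ring
  rw [hconj, bubbleF_conj, sub_neg_eq_add]
  rfl
end

section
/- Let m₁, m₂ > 0 and define F(z) = ∫₀¹ (−iπ)/(z·α·(1−α) − m₁²·α − m₂²·(1−α)) dα for z ∈ ℂ with Im z ≠ 0. Then for every real s < (m₁+m₂)², lim_{ε→0⁺} ( F(s+iε) − F(s−iε) ) = 0. In particular the bubble integral has no discontinuity at the pseudothreshold s = (m₁−m₂)² on the physical sheet. -/
theorem bubble_symanzik_pos {m₁ m₂ s α : ℝ} (hm₁ : 0 < m₁) (hm₂ : 0 < m₂)
    (hs : s < (m₁ + m₂) ^ 2) (hα : α ∈ Set.Icc (0 : ℝ) 1) :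
    0 < m₁ ^ 2 * α + m₂ ^ 2 * (1 - α) - s * α * (1 - α) := by
  have key : m₁ ^ 2 * α + m₂ ^ 2 * (1 - α) - s * α * (1 - α) =
      ((m₁ + m₂) ^ 2 - s) * (α * (1 - α)) + (m₁ * α - m₂ * (1 - α)) ^ 2 := by ring
  rw [key]
  rcases hα.1.eq_or_lt with rfl | h0
  · simpa using pow_pos hm₂ 2
  rcases hα.2.eq_or_lt with rfl | h1
  · simpa using pow_pos hm₁ 2
  have : 0 < ((m₁ + m₂) ^ 2 - s) * (α * (1 - α)) :=
    mul_pos (sub_pos.2 hs) (mul_pos h0 (sub_pos.2 h1))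
  positivity

theorem bubble_symanzik_le_norm {m₁ m₂ s α : ℝ} {z : ℂ} (hz : z.re ≤ s)
    (hα : α ∈ Set.Icc (0 : ℝ) 1) :
    m₁ ^ 2 * α + m₂ ^ 2 * (1 - α) - s * α * (1 - α) ≤
      ‖z * (α : ℂ) * (1 - (α : ℂ)) - (m₁ : ℂ) ^ 2 * (α : ℂ) -
        (m₂ : ℂ) ^ 2 * (1 - (α : ℂ))‖ := by
  have hre : (z * (α : ℂ) * (1 - (α : ℂ)) - (m₁ : ℂ) ^ 2 * (α : ℂ) -
      (m₂ : ℂ) ^ 2 * (1 - (α : ℂ))).re =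
      z.re * α * (1 - α) - m₁ ^ 2 * α - m₂ ^ 2 * (1 - α) := by
    simp [pow_two]
  refine le_trans ?_ ((neg_le_abs _).trans (Complex.abs_re_le_norm _))
  rw [hre]
  have : z.re * (α * (1 - α)) ≤ s * (α * (1 - α)) :=
    mul_le_mul_of_nonneg_right hz (mul_nonneg hα.1 (sub_nonneg.2 hα.2))
  linarith

/-- The bubble integral is continuous on the half-plane to the left of the normal threshold. -/
theorem continuousAt_bubbleF {m₁ m₂ : ℝ} (hm₁ : 0 < m₁) (hm₂ : 0 < m₂) {z : ℂ}
    (hz : z.re < (m₁ + m₂) ^ 2) : ContinuousAt (bubbleF m₁ m₂) z := by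
  obtain ⟨t, hzt, ht⟩ := exists_between hz
  have hev : ∀ᶠ w : ℂ in nhds z, w.re ≤ t :=
    (Complex.continuous_re.continuousAt.eventually_lt_const hzt).mono fun _ h => h.le
  have huIcc : ∀ {α : ℝ}, α ∈ Set.uIoc (0 : ℝ) 1 → α ∈ Set.Icc (0 : ℝ) 1 := fun h =>
    Set.Ioc_subset_Icc_self (Set.uIoc_of_le (zero_le_one' ℝ) ▸ h)
  refine intervalIntegral.continuousAt_of_dominated_interval
    (bound := fun α => Real.pi / (m₁ ^ 2 * α + m₂ ^ 2 * (1 - α) - t * α * (1 - α))) ?_ ?_ ?_ ?_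
  · exact Filter.Eventually.of_forall fun w =>
      (Measurable.aestronglyMeasurable (by fun_prop))
  · filter_upwards [hev] with w hw
    refine Filter.Eventually.of_forall fun α hα => ?_
    rw [norm_div, norm_mul, norm_neg, Complex.norm_I, one_mul, Complex.norm_real,
      Real.norm_of_nonneg Real.pi_pos.le]
    exact div_le_div_of_nonneg_left Real.pi_pos.le (bubble_symanzik_pos hm₁ hm₂ ht (huIcc hα))
      (bubble_symanzik_le_norm hw (huIcc hα))
  · refine ContinuousOn.intervalIntegrable ?_
    rw [Set.uIcc_of_le zero_le_one]
    exact ContinuousOn.div (by fun_prop) (by fun_prop)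
      fun α hα => (bubble_symanzik_pos hm₁ hm₂ ht hα).ne'
  · refine Filter.Eventually.of_forall fun α hα => ?_
    refine ContinuousAt.div (by fun_prop) (by fun_prop) (norm_pos_iff.1 ?_)
    exact (bubble_symanzik_pos hm₁ hm₂ ht (huIcc hα)).trans_le
      (bubble_symanzik_le_norm hzt.le (huIcc hα))


/-- Below the normal threshold the bubble integral has no discontinuity across the
real axis; in particular there is no branch cut at the pseudothreshold on the
physical sheet. -/
theorem bubble_no_discontinuity_below_threshold (m₁ m₂ : ℝ) (hm₁ : 0 < m₁) (hm₂ : 0 < m₂)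
    (s : ℝ) (hs : s < (m₁ + m₂) ^ 2) :
    Filter.Tendsto
      (fun ε : ℝ =>
        bubbleF m₁ m₂ ((s : ℂ) + (ε : ℂ) * Complex.I) -
          bubbleF m₁ m₂ ((s : ℂ) - (ε : ℂ) * Complex.I))
      (nhdsWithin 0 (Set.Ioi 0)) (nhds (0 : ℂ)) := by
  have hF : ContinuousAt (bubbleF m₁ m₂) (s : ℂ) := continuousAt_bubbleF hm₁ hm₂ (by simpa using hs)
  have hadd : Filter.Tendsto (fun ε : ℝ => (s : ℂ) + (ε : ℂ) * Complex.I)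
      (nhdsWithin 0 (Set.Ioi 0)) (nhds (s : ℂ)) :=
    ((by fun_prop : Continuous fun ε : ℝ => (s : ℂ) + (ε : ℂ) * Complex.I).tendsto' 0 _
      (by simp)).mono_left nhdsWithin_le_nhds
  have hsub : Filter.Tendsto (fun ε : ℝ => (s : ℂ) - (ε : ℂ) * Complex.I)
      (nhdsWithin 0 (Set.Ioi 0)) (nhds (s : ℂ)) :=
    ((by fun_prop : Continuous fun ε : ℝ => (s : ℂ) - (ε : ℂ) * Complex.I).tendsto' 0 _
      (by simp)).mono_left nhdsWithin_le_nhds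
  simpa using (hF.tendsto.comp hadd).sub (hF.tendsto.comp hsub)
end

section
/- Let X = {(z₁,z₂) ∈ ℂ × ℂ : z₁ ≠ 0 and z₁ ≠ z₂²} with basepoint (1,0), and define the loops γ(u) = (e^{2πiu}, 0), η₊(u) = (1, 1−e^{2πiu}), η₋(u) = (1, e^{2πiu}−1) for u ∈ [0,1], all of which lie in X and are based at (1,0). Then the concatenated loop 'η₊ followed by γ' is path-homotopic rel endpoints, within X, to the loop 'γ followed by η₋'; likewise 'η₋ followed by γ' is path-homotopic to 'γ followed by η₊'. Equivalently, in π₁(X,(1,0)) one has γ·η₊·γ⁻¹ = η₋ and γ·η₋·γ⁻¹ = η₊. -/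
/-- The complement of the local model of two tangentially intersecting Pham loci:
the line `z₁ = 0` and the parabola `z₁ = z₂²`. -/
def tangentModelComplement : Set (ℂ × ℂ) := {p | p.1 ≠ 0 ∧ p.1 ≠ p.2 ^ 2}

/-- The basepoint `(1,0)`. -/
noncomputable def tangentBasepoint : tangentModelComplement :=
  ⟨(1, 0), by constructor <;> norm_num⟩

/-- The two ways around the boundary of a continuous square are homotopic. -/
theorem Path.Homotopic.trans_of_square {X : Type*} [TopologicalSpace X] {a b c d : X}
    (F : C(unitInterval × unitInterval, X))
    (p : Path a b) (q : Path b d) (r : Path a c) (s : Path c d)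
    (hp : ∀ u, p u = F (0, u)) (hq : ∀ t, q t = F (t, 1))
    (hr : ∀ t, r t = F (t, 0)) (hs : ∀ u, s u = F (1, u)) :
    (p.trans q).Homotopic (r.trans s) := by
  obtain rfl : a = F (0, 0) := by rw [← hp, p.source]
  obtain rfl : b = F (0, 1) := by rw [← hp, p.target]
  obtain rfl : c = F (1, 0) := by rw [← hr, r.target]
  obtain rfl : d = F (1, 1) := by rw [← hs, s.target]
  have : ContractibleSpace unitInterval :=
    (convex_Icc (0 : ℝ) 1).contractibleSpace ⟨0, by simp⟩
  let ι : Path (0 : unitInterval) 1 := ⟨.id _, rfl, rfl⟩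
  let left : Path ((0, 0) : unitInterval × unitInterval) (0, 1) := (Path.refl 0).prod ι
  let top : Path ((0, 1) : unitInterval × unitInterval) (1, 1) := ι.prod (Path.refl 1)
  let bottom : Path ((0, 0) : unitInterval × unitInterval) (1, 0) := ι.prod (Path.refl 0)
  let right : Path ((1, 0) : unitInterval × unitInterval) (1, 1) := (Path.refl 1).prod ι
  obtain rfl : p = left.map F.continuous := Path.ext (funext hp)
  obtain rfl : q = top.map F.continuous := Path.ext (funext hq)
  obtain rfl : r = bottom.map F.continuous := Path.ext (funext hr)
  obtain rfl : s = right.map F.continuous := Path.ext (funext hs)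
  rw [← Path.map_trans, ← Path.map_trans]
  exact (SimplyConnectedSpace.paths_homotopic (left.trans top) (bottom.trans right)).map F

theorem mem_tangentModelComplement_of_sq {v w : ℂ} (hv : v ≠ 0) (hw : ‖w‖ = 1) :
    (v ^ 2, v * (1 - w)) ∈ tangentModelComplement := by
  refine ⟨pow_ne_zero 2 hv, fun h => ?_⟩
  have h' : v ^ 2 * (w * (w - 2)) = 0 := by linear_combination -h
  rcases mul_eq_zero.1 ((mul_eq_zero.1 h').resolve_left (pow_ne_zero 2 hv)) with h0 | h2
  · simp [h0] at hw
  · simp [sub_eq_zero.1 h2] at hw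

/-- The square `(t, u) ↦ (e^{2πit}, v e^{πit}(1 - e^{2πiu}))`, where `v = ±1` selects the branch
of the parabola being encircled. -/
noncomputable def tangentSquare (v : ℂ) (hv : v ^ 2 = 1) :
    C(unitInterval × unitInterval, tangentModelComplement) where
  toFun x := ⟨((v * Complex.exp (Real.pi * Complex.I * ((x.1 : ℝ) : ℂ))) ^ 2,
      v * Complex.exp (Real.pi * Complex.I * ((x.1 : ℝ) : ℂ)) *
        (1 - Complex.exp (2 * Real.pi * Complex.I * ((x.2 : ℝ) : ℂ)))),
    mem_tangentModelComplement_of_sq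
      (mul_ne_zero (by rintro rfl; simp at hv) (Complex.exp_ne_zero _))
      (by
        rw [← Complex.norm_exp_ofReal_mul_I (2 * Real.pi * x.2)]
        push_cast
        ring_nf)⟩
  continuous_toFun := by fun_prop

theorem tangentSquare_apply (v : ℂ) (hv : v ^ 2 = 1) (t u : unitInterval) :
    (tangentSquare v hv (t, u) : ℂ × ℂ) =
      (Complex.exp (2 * Real.pi * Complex.I * ((t : ℝ) : ℂ)),
        v * Complex.exp (Real.pi * Complex.I * ((t : ℝ) : ℂ)) *
          (1 - Complex.exp (2 * Real.pi * Complex.I * ((u : ℝ) : ℂ)))) := by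
  refine Prod.ext ?_ rfl
  change (v * Complex.exp (Real.pi * Complex.I * ((t : ℝ) : ℂ))) ^ 2 = _
  rw [mul_pow, hv, one_mul, ← Complex.exp_nat_mul]
  push_cast
  ring_nf

/-- Conjugation by the loop `γ` encircling both loci exchanges the loops `η₊`, `η₋`
around the two branches of the parabola: `γ·η₊·γ⁻¹ = η₋` and `γ·η₋·γ⁻¹ = η₊` in the
fundamental group, i.e. "η₊ then γ" is path-homotopic to "γ then η₋" and vice versa. -/
theorem tangential_monodromy_conjugation
    (γ ηp ηm : Path tangentBasepoint tangentBasepoint)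
    (hγ : ∀ t : unitInterval,
      (γ t : ℂ × ℂ) = (Complex.exp (2 * Real.pi * Complex.I * ((t : ℝ) : ℂ)), 0))
    (hηp : ∀ t : unitInterval,
      (ηp t : ℂ × ℂ) = (1, 1 - Complex.exp (2 * Real.pi * Complex.I * ((t : ℝ) : ℂ))))
    (hηm : ∀ t : unitInterval,
      (ηm t : ℂ × ℂ) = (1, Complex.exp (2 * Real.pi * Complex.I * ((t : ℝ) : ℂ)) - 1)) :
    (ηp.trans γ).Homotopic (γ.trans ηm) ∧ (ηm.trans γ).Homotopic (γ.trans ηp) := by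
  constructor
  · apply Path.Homotopic.trans_of_square (tangentSquare 1 (by norm_num)) <;> intro t <;>
      apply Subtype.ext <;>
      simp [tangentSquare_apply, hγ, hηp, hηm, Complex.exp_two_pi_mul_I, Complex.exp_pi_mul_I]
  · apply Path.Homotopic.trans_of_square (tangentSquare (-1) (by norm_num)) <;> intro t <;>
      apply Subtype.ext <;>
      simp [tangentSquare_apply, hγ, hηp, hηm, Complex.exp_two_pi_mul_I, Complex.exp_pi_mul_I]
end

section
/- Let E = {(x,y) ∈ ℂ × ℂ : y ≠ 0 and y ≠ x²}, with basepoint (0,1) ∈ E. Then the fundamental group π₁(E,(0,1)) is isomorphic to the semidirect product F₂ ⋊_φ ℤ, where F₂ is the free group on two generators and φ : ℤ → Aut(F₂) sends 1 to the automorphism of F₂ that exchanges the two generators. -/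
/-- The complement of the two curves `y = 0` and `y = x²` in `ℂ²`: the local model of a
pair of Pham loci meeting tangentially with quadratic contact. -/
def parabolaComplement : Set (ℂ × ℂ) := {p | p.2 ≠ 0 ∧ p.2 ≠ p.1 ^ 2}

/-- The basepoint `(0,1)`. -/
noncomputable def parabolaBasepoint : parabolaComplement :=
  ⟨(0, 1), by constructor <;> norm_num⟩

/-- The automorphism of the free group on two generators exchanging the generators. -/
noncomputable def swapGenerators : MulAut (FreeGroup (Fin 2)) :=
  FreeGroup.freeGroupCongr (Equiv.swap 0 1)

/-- The action `φ : ℤ → Aut(F₂)` sending `1` to the exchange of the two generators. -/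
noncomputable def exchangeAction : Multiplicative ℤ →* MulAut (FreeGroup (Fin 2)) :=
  zpowersHom (MulAut (FreeGroup (Fin 2))) swapGenerators

open unitInterval Bundle

theorem Path.Homotopic.Quotient.mk_subpath_trans {X : Type*} [TopologicalSpace X] {a b : X}
    (γ : Path a b) (t₀ t₁ t₂ : I) :
    (Path.Homotopic.Quotient.mk (γ.subpath t₀ t₁)).trans
      (Path.Homotopic.Quotient.mk (γ.subpath t₁ t₂)) =
      Path.Homotopic.Quotient.mk (γ.subpath t₀ t₂) := by
  rw [← Path.Homotopic.Quotient.mk_trans]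
  exact Path.Homotopic.Quotient.eq.2 ⟨Path.Homotopy.subpathTransSubpath γ t₀ t₁ t₂⟩

theorem FundamentalGroup.eq_top_of_transition_mem {X ι : Type*} [TopologicalSpace X]
    {U : ι → Set X} (hU : ∀ i, IsOpen (U i)) (hcov : ∀ x, ∃ i, x ∈ U i) {x₀ : X}
    (α : ∀ i x, x ∈ U i → Path.Homotopic.Quotient x₀ x)
    (hα : ∀ i x y (hx : x ∈ U i) (hy : y ∈ U i) (p : Path x y), (∀ t, p t ∈ U i) →
      (α i x hx).trans (.mk p) = α i y hy)
    (H : Subgroup (FundamentalGroup X x₀)) {i₀ : ι} (h₀ : x₀ ∈ U i₀)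
    (hα₀ : α i₀ x₀ h₀ = .refl x₀)
    (hH : ∀ i j x (hi : x ∈ U i) (hj : x ∈ U j),
      FundamentalGroup.fromPath ((α i x hi).trans (α j x hj).symm) ∈ H) :
    H = ⊤ := by
  rw [Subgroup.eq_top_iff']
  intro g
  obtain ⟨γ, rfl⟩ := Path.Homotopic.Quotient.mk_surjective g
  obtain ⟨t, t_0, t_mono, ⟨m, hm⟩, t_sub⟩ :=
    exists_monotone_Icc_subset_open_cover_unitInterval
      (fun i ↦ (hU i).preimage γ.continuous)
      (fun s _ ↦ Set.mem_iUnion.2 (hcov (γ s)))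
  have key : ∀ n i (hi : γ (t n) ∈ U i), FundamentalGroup.fromPath
      (((Path.Homotopic.Quotient.mk (γ.subpath 0 (t n))).cast γ.source.symm rfl).trans
        (α i _ hi).symm) ∈ H := by
    intro n
    induction n with
    | zero =>
      intro i hi
      have hz : (Path.Homotopic.Quotient.mk (γ.subpath 0 (t 0))).cast γ.source.symm rfl =
          α i₀ (γ (t 0)) (by rw [t_0]; simpa using h₀) := by
        rw [← hα i₀ x₀ _ h₀ _ ((γ.subpath 0 (t 0)).cast γ.source.symm rfl) _, hα₀]
        · simp [Path.Homotopic.Quotient.mk_cast]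
        · intro s
          have hs : ∀ u : I, u = 0 → γ.subpath 0 u s = x₀ := by
            rintro _ rfl
            simp
          exact (hs _ t_0).symm ▸ h₀
      rw [hz]
      exact hH _ _ _ _ _
    | succ n ih =>
      intro i hi
      obtain ⟨j, hj⟩ := t_sub n
      have hjn : γ (t n) ∈ U j := hj ⟨le_rfl, t_mono n.le_succ⟩
      have hjs : γ (t (n + 1)) ∈ U j := hj ⟨t_mono n.le_succ, le_rfl⟩
      have hstep := hα j _ _ hjn hjs (γ.subpath (t n) (t (n + 1))) (by
        intro s
        have : γ.subpath (t n) (t (n + 1)) s ∈ Set.range (γ.subpath (t n) (t (n + 1))) := ⟨s, rfl⟩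
        rw [Path.range_subpath_of_le _ _ _ (t_mono n.le_succ)] at this
        obtain ⟨s', hs', h⟩ := this
        exact h ▸ hj hs')
      have e : ((Path.Homotopic.Quotient.mk (γ.subpath 0 (t (n + 1)))).cast
          γ.source.symm rfl).trans (α i _ hi).symm =
          (((Path.Homotopic.Quotient.mk (γ.subpath 0 (t n))).cast γ.source.symm rfl).trans
          (α j _ hjn).symm).trans ((α j _ hjs).trans (α i _ hi).symm) := by
        have e' : (Path.Homotopic.Quotient.mk (γ.subpath 0 (t (n + 1)))).cast γ.source.symm rfl =
          ((Path.Homotopic.Quotient.mk (γ.subpath 0 (t n))).cast γ.source.symm rfl).trans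
            (.mk (γ.subpath (t n) (t (n + 1)))) := by
          rw [← Path.Homotopic.Quotient.mk_subpath_trans γ 0 (t n)]
          rfl
        rw [e', ← hstep]
        simp only [Path.Homotopic.Quotient.trans_assoc]
        rw [← Path.Homotopic.Quotient.trans_assoc (α j _ hjn).symm (α j _ hjn)]
        simp
      rw [e]
      exact H.mul_mem (hH _ _ _ _ _) (ih j hjn)
  have hend : ∀ y (hy : y = x₀) (hyU : y ∈ U i₀),
      ((Path.Homotopic.Quotient.mk γ).cast rfl hy).trans (α i₀ y hyU).symm = .mk γ := by
    rintro _ rfl hyU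
    rw [hα₀]
    exact Path.Homotopic.Quotient.trans_refl _
  have hlast := key m i₀
  rw [hm m le_rfl, Path.subpath_zero_one] at hlast
  exact (congrArg (· ∈ H) (hend _ γ.target (by simpa using h₀))).mp (hlast (by simpa using h₀))

/-- The principal bundle with discrete structure group glued from a locally constant cocycle. -/
def FiberBundleCore.ofCocycle {X ι G : Type*} [TopologicalSpace X] [Group G] [TopologicalSpace G]
    [DiscreteTopology G] {U : ι → Set X} (hU : ∀ i, IsOpen (U i)) (index : X → ι)
    (hindex : ∀ x, x ∈ U (index x)) (c : ι → ι → X → G)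
    (hc : ∀ i j, ContinuousOn (c i j) (U i ∩ U j)) (hc₁ : ∀ i x, c i i x = 1)
    (hc₂ : ∀ i j k x, c j k x * c i j x = c i k x) : FiberBundleCore ι X G where
  baseSet := U
  isOpen_baseSet := hU
  indexAt := index
  mem_baseSet_at := hindex
  coordChange i j x g := c i j x * g
  coordChange_self i x _ g := by simp [hc₁]
  continuousOn_coordChange i j :=
    ((hc i j).comp continuousOn_fst fun _ h ↦ h.1).mul continuousOn_snd
  coordChange_comp i j k x _ g := by simp [← mul_assoc, hc₂]

theorem Bundle.Trivialization.monodromy_mk {X Y F : Type*} [TopologicalSpace X]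
    [TopologicalSpace Y] [TopologicalSpace F] {p : Y → X} (cov : IsCoveringMap p)
    (e : Trivialization F p) {x y : X} (γ : Path x y) (hγ : ∀ t, γ t ∈ e.baseSet) (f : F)
    {a : p ⁻¹' {x}} {b : p ⁻¹' {y}} (ha : a.1 = e.toOpenPartialHomeomorph.symm (x, f))
    (hb : b.1 = e.toOpenPartialHomeomorph.symm (y, f)) :
    cov.monodromy (.mk γ) a = b := by
  have hcont : Continuous fun t : I ↦ e.toOpenPartialHomeomorph.symm (γ t, f) :=
    e.continuousOn_invFun.comp_continuous (by fun_prop) fun t ↦ by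
      simpa [e.target_eq] using hγ t
  let Γ : Path a.1 b.1 := ⟨⟨_, hcont⟩, by simp [ha], by simp [hb]⟩
  refine cov.monodromy_eq_of_map_eq (.mk Γ) ?_
  exact congrArg Path.Homotopic.Quotient.mk (show Γ.map cov.continuous = γ.cast a.2 b.2 from
    Path.ext (funext fun t ↦ e.proj_symm_apply' (hγ t)))

theorem FundamentalGroup.exists_monodromy_of_cocycle {X ι G : Type*} [TopologicalSpace X] [Group G]
    {U : ι → Set X} (hU : ∀ i, IsOpen (U i)) (hcov : ∀ x, ∃ i, x ∈ U i) (c : ι → ι → X → G)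
    (hc : ∀ i j x, x ∈ U i → x ∈ U j → ∀ᶠ y in nhds x, c i j y = c i j x)
    (hc₁ : ∀ i x, c i i x = 1) (hc₂ : ∀ i j k x, c j k x * c i j x = c i k x)
    {x₀ : X} (hx₀ : ∀ i j, c i j x₀ = 1) :
    ∃ Φ : FundamentalGroup X x₀ →* Equiv.Perm G, ∀ i j x (p q : Path x₀ x),
      (∀ t, p t ∈ U i) → (∀ t, q t ∈ U j) →
      Φ (FundamentalGroup.fromPath ((Path.Homotopic.Quotient.mk p).trans
        (Path.Homotopic.Quotient.mk q).symm)) = MulAction.toPerm (c i j x) := by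
  choose index hindex using hcov
  let : TopologicalSpace G := ⊥
  have : DiscreteTopology G := ⟨rfl⟩
  let Z := FiberBundleCore.ofCocycle hU index hindex c
    (fun i j x hx ↦ by
      refine (continuousAt_const.congr (f := fun _ ↦ c i j x) ?_).continuousWithinAt
      filter_upwards [hc i j x hx.1 hx.2] with y hy using hy.symm) hc₁ hc₂
  have cov : IsCoveringMap Z.proj := FiberBundle.isCoveringMap (F := G) (E := Z.Fiber)
  let s (x : X) (g : G) : Z.proj ⁻¹' {x} := ⟨⟨x, g⟩, rfl⟩
  have hs : Function.Bijective (s x₀) := by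
    refine ⟨fun g h hgh ↦ ?_, ?_⟩
    · exact Bundle.TotalSpace.mk_injective (F := G) (E := Z.Fiber) x₀ (congrArg Subtype.val hgh)
    · rintro ⟨⟨x, g⟩, rfl : x = x₀⟩
      exact ⟨g, rfl⟩
  have hmono : ∀ i x y (p : Path x y), (∀ t, p t ∈ U i) → ∀ g,
      cov.monodromy (.mk p) (s x (c i (index x) x * g)) = s y (c i (index y) y * g) :=
    fun i x y p hp g ↦ (Z.localTriv i).monodromy_mk cov p hp g rfl rfl
  let E : G ≃ Z.proj ⁻¹' {x₀} := Equiv.ofBijective _ hs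
  refine ⟨E.symm.permCongrHom.toMonoidHom.comp (cov.monodromyPerm x₀), ?_⟩
  intro i j x p q hp hq
  ext g
  simp only [MulEquiv.toMonoidHom_eq_coe, MonoidHom.coe_comp, MonoidHom.coe_coe, Function.comp_apply,
    Equiv.permCongrHom_coe, Equiv.permCongr_apply, Equiv.symm_symm, IsCoveringMap.coe_monodromyPerm,
    MulAction.toPerm_apply, smul_eq_mul]
  rw [Equiv.symm_apply_eq, cov.monodromy_trans_apply]
  have h₁ := hmono i _ _ p hp g
  have h₂ := hmono j _ _ q.symm (fun t ↦ hq _) (c i j x * g)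
  rw [← mul_assoc, hc₂] at h₂
  rw [hx₀, one_mul] at h₁ h₂
  exact (congrArg _ h₁).trans h₂

/-- The complex plane without the points `1` and `-1`. -/
def twicePuncturedPlane : Set ℂ := {u | u ^ 2 ≠ 1}

/-- The sign attached to an index: `1` for `0` and `-1` for `1`. -/
def slitSign (k : Fin 2) : ℝ := (-1) ^ (k : ℕ)

theorem slitSign_mul_self (k : Fin 2) : slitSign k * slitSign k = 1 := by
  fin_cases k <;> simp [slitSign]

theorem slitSign_swap (k : Fin 2) : slitSign (Equiv.swap 0 1 k) = -slitSign k := by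
  fin_cases k <;> simp [slitSign]

theorem mem_twicePuncturedPlane_of_re {z : ℂ} (s : ℝ) (h : z.re ^ 2 = 1 → 0 < s * z.im) :
    z ∈ twicePuncturedPlane := by
  intro hz
  rcases mul_self_eq_one_iff.1 ((pow_two z).symm.trans hz) with rfl | rfl <;> simp at h

/-- The plane slit along the vertical rays issuing from both punctures, downwards for `k = 0` and
upwards for `k = 1`. -/
def slitPlane (k : Fin 2) : Set twicePuncturedPlane :=
  {u | (u : ℂ).re ^ 2 = 1 → 0 < slitSign k * (u : ℂ).im}

theorem isOpen_slitPlane (k : Fin 2) : IsOpen (slitPlane k) := by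
  have : slitPlane k = ({u | (u : ℂ).re ^ 2 ≠ 1} : Set twicePuncturedPlane) ∪
      {u | 0 < slitSign k * (u : ℂ).im} := by
    ext u
    simp [slitPlane, imp_iff_not_or]
  rw [this]
  exact (isOpen_ne_fun (by fun_prop) (by fun_prop)).union
    (isOpen_lt (by fun_prop) (by fun_prop))

theorem exists_mem_slitPlane (u : twicePuncturedPlane) : ∃ k, u ∈ slitPlane k := by
  by_cases h : (u : ℂ).re ^ 2 = 1
  · have him : (u : ℂ).im ≠ 0 := by
      intro h0
      apply u.2
      apply Complex.ext
      · simp [pow_two, h0, ← h]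
      · simp [pow_two, h0]
    rcases him.lt_or_gt with h0 | h0
    · exact ⟨1, fun _ ↦ by simpa [slitSign] using h0⟩
    · exact ⟨0, fun _ ↦ by simpa [slitSign] using h0⟩
  · exact ⟨0, fun h' ↦ absurd h' h⟩

theorem re_sq_ne_one_of_mem_slitPlane {i j : Fin 2} (hij : i ≠ j) {u : twicePuncturedPlane}
    (hi : u ∈ slitPlane i) (hj : u ∈ slitPlane j) : (u : ℂ).re ^ 2 ≠ 1 := by
  intro h
  have h₁ := hi h
  have h₂ := hj h
  fin_cases i <;> fin_cases j <;> simp_all [slitSign] <;> linarith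

instance contractibleSpace_slitPlane (k : Fin 2) : ContractibleSpace (slitPlane k) := by
  rw [contractible_iff_id_nullhomotopic]
  have hσ := slitSign_mul_self k
  have him (z : ℂ) : 0 < slitSign k * (z.im + slitSign k * (|z.im| + 1)) := by
    rw [mul_add, ← mul_assoc, hσ]
    have : |slitSign k * z.im| = |z.im| := by
      rw [abs_mul, show |slitSign k| = 1 by fin_cases k <;> simp [slitSign], one_mul]
    linarith [neg_abs_le (slitSign k * z.im)]
  let mk (z : ℂ) (h : z.re ^ 2 = 1 → 0 < slitSign k * z.im) : slitPlane k :=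
    ⟨⟨z, mem_twicePuncturedPlane_of_re _ h⟩, h⟩
  let H₁ (r : I) (u : slitPlane k) : slitPlane k :=
    mk (u + ((r * (slitSign k * (|(u : ℂ).im| + 1)) : ℝ) : ℂ) * Complex.I) fun h ↦ by
      have := u.2 (by simpa using h)
      have h0 : 0 ≤ (r : ℝ) := r.2.1
      simp only [Complex.add_im, Complex.mul_im, Complex.ofReal_re, Complex.ofReal_im,
        Complex.I_im, Complex.I_re]
      have e : slitSign k * ((u : ℂ).im + (r * (slitSign k * (|(u : ℂ).im| + 1)) * 1 + 0 * 0)) =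
        slitSign k * (u : ℂ).im + slitSign k * slitSign k * (r * (|(u : ℂ).im| + 1)) := by ring
      rw [e, hσ]
      positivity
  let H₂ (r : I) (u : slitPlane k) : slitPlane k :=
    mk (((1 - r : ℝ) : ℂ) * (u + ((slitSign k * (|(u : ℂ).im| + 1) : ℝ) : ℂ) * Complex.I) +
        ((r : ℝ) : ℂ) * ((slitSign k : ℂ) * Complex.I)) fun _ ↦ by
      have h1 := him u
      have h0 : 0 ≤ (r : ℝ) := r.2.1
      have h2 : 0 ≤ 1 - (r : ℝ) := sub_nonneg.2 r.2.2
      simp only [Complex.add_im, Complex.mul_im, Complex.ofReal_re, Complex.ofReal_im,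
        Complex.I_im, Complex.I_re]
      have e : slitSign k * ((1 - (r : ℝ)) * ((u : ℂ).im + (slitSign k * (|(u : ℂ).im| + 1)))) +
        slitSign k * slitSign k * r =
        (1 - (r : ℝ)) * (slitSign k * ((u : ℂ).im + slitSign k * (|(u : ℂ).im| + 1))) + r := by
          rw [hσ]; ring
      rcases h0.eq_or_lt with h | h
      · simp [← h]; linarith
      · have := mul_nonneg h2 h1.le
        ring_nf at e this ⊢
        linarith
  have hH₁ : Continuous fun p : I × slitPlane k ↦ H₁ p.1 p.2 :=
    Continuous.subtype_mk (Continuous.subtype_mk (by fun_prop) _) _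
  have hH₂ : Continuous fun p : I × slitPlane k ↦ H₂ p.1 p.2 :=
    Continuous.subtype_mk (Continuous.subtype_mk (by fun_prop) _) _
  refine ⟨mk ((slitSign k : ℂ) * Complex.I) fun _ ↦ by simp [hσ], ?_⟩
  refine ContinuousMap.Homotopic.trans (g := ⟨H₁ 1, by fun_prop⟩) ⟨⟨⟨_, hH₁⟩, ?_, ?_⟩⟩
    ⟨⟨⟨_, hH₂⟩, ?_, ?_⟩⟩
  · intro u
    ext
    simp [H₁, mk]
  · intro u
    rfl
  · intro u
    ext
    simp [H₁, H₂, mk]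
  · intro u
    ext
    simp [H₂, mk]

theorem zero_mem_twicePuncturedPlane : (0 : ℂ) ∈ twicePuncturedPlane := by
  simp [twicePuncturedPlane]

/-- The origin as a point of the twice punctured plane. -/
def puncturedOrigin : twicePuncturedPlane := ⟨0, zero_mem_twicePuncturedPlane⟩

theorem puncturedOrigin_mem_slitPlane (k : Fin 2) : puncturedOrigin ∈ slitPlane k := by
  simp [slitPlane, puncturedOrigin]

theorem mem_slitPlane_of_re {u : twicePuncturedPlane} (h : (u : ℂ).re ^ 2 ≠ 1) (k : Fin 2) :
    u ∈ slitPlane k := fun h' ↦ absurd h' h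

/-- A path inside a slit plane. -/
noncomputable def slitPath (k : Fin 2) {x y : twicePuncturedPlane} (hx : x ∈ slitPlane k)
    (hy : y ∈ slitPlane k) : Path x y :=
  (PathConnectedSpace.somePath (⟨x, hx⟩ : slitPlane k) ⟨y, hy⟩).map continuous_subtype_val

theorem slitPath_mem (k : Fin 2) {x y : twicePuncturedPlane} (hx : x ∈ slitPlane k)
    (hy : y ∈ slitPlane k) (t : I) : slitPath k hx hy t ∈ slitPlane k :=
  (PathConnectedSpace.somePath (⟨x, hx⟩ : slitPlane k) ⟨y, hy⟩ t).2

theorem mk_eq_mk_of_mem_slitPlane {k : Fin 2} {x y : twicePuncturedPlane} {p q : Path x y}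
    (hp : ∀ t, p t ∈ slitPlane k) (hq : ∀ t, q t ∈ slitPlane k) :
    Path.Homotopic.Quotient.mk p = Path.Homotopic.Quotient.mk q := by
  have hx : x ∈ slitPlane k := by simpa using hp 0
  have hy : y ∈ slitPlane k := by simpa using hp 1
  let p' : Path (⟨x, hx⟩ : slitPlane k) ⟨y, hy⟩ :=
    ⟨⟨fun t ↦ ⟨p t, hp t⟩, by fun_prop⟩, by simp, by simp⟩
  let q' : Path (⟨x, hx⟩ : slitPlane k) ⟨y, hy⟩ :=
    ⟨⟨fun t ↦ ⟨q t, hq t⟩, by fun_prop⟩, by simp, by simp⟩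
  exact Path.Homotopic.Quotient.eq.2
    ((SimplyConnectedSpace.paths_homotopic p' q').map ⟨Subtype.val, continuous_subtype_val⟩)

theorem slitPath_trans {k : Fin 2} {x y z : twicePuncturedPlane} (hx : x ∈ slitPlane k)
    (hy : y ∈ slitPlane k) (hz : z ∈ slitPlane k) (p : Path y z) (hp : ∀ t, p t ∈ slitPlane k) :
    (Path.Homotopic.Quotient.mk (slitPath k hx hy)).trans (.mk p) = .mk (slitPath k hx hz) := by
  rw [← Path.Homotopic.Quotient.mk_trans]
  refine mk_eq_mk_of_mem_slitPlane (k := k) (fun t ↦ ?_) (slitPath_mem _ _ _)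
  rw [Path.trans_apply]
  split_ifs
  · exact slitPath_mem _ _ _ _
  · exact hp _

/-- The loop at the origin reaching `x` in the slit plane `i` and returning in the slit plane `j`. -/
noncomputable def slitLoop (i j : Fin 2) (x : twicePuncturedPlane) (hi : x ∈ slitPlane i)
    (hj : x ∈ slitPlane j) : FundamentalGroup twicePuncturedPlane puncturedOrigin :=
  FundamentalGroup.fromPath
    ((Path.Homotopic.Quotient.mk (slitPath i (puncturedOrigin_mem_slitPlane i) hi)).trans
      (Path.Homotopic.Quotient.mk (slitPath j (puncturedOrigin_mem_slitPlane j) hj)).symm)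

theorem slitLoop_self (i : Fin 2) (x : twicePuncturedPlane) (hi hi' : x ∈ slitPlane i) :
    slitLoop i i x hi hi' = 1 :=
  Path.Homotopic.Quotient.trans_symm _

theorem slitLoop_inv (i j : Fin 2) (x : twicePuncturedPlane) (hi : x ∈ slitPlane i)
    (hj : x ∈ slitPlane j) : (slitLoop i j x hi hj)⁻¹ = slitLoop j i x hj hi := by
  simp only [slitLoop, FundamentalGroup.inv_def]
  simp [← Path.Homotopic.Quotient.mk_symm, ← Path.Homotopic.Quotient.mk_trans,
    FundamentalGroup.fromPath]

theorem slitLoop_eq_of_path (i j : Fin 2) {x y : twicePuncturedPlane} (p : Path x y)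
    (hpi : ∀ t, p t ∈ slitPlane i) (hpj : ∀ t, p t ∈ slitPlane j) (hxi : x ∈ slitPlane i)
    (hxj : x ∈ slitPlane j) (hyi : y ∈ slitPlane i) (hyj : y ∈ slitPlane j) :
    slitLoop i j x hxi hxj = slitLoop i j y hyi hyj := by
  rw [slitLoop, slitLoop, ← slitPath_trans _ hxi hyi p hpi, ← slitPath_trans _ hxj hyj p hpj]
  congr 1
  simp only [← Path.Homotopic.Quotient.mk_symm, Path.trans_symm, ← Path.Homotopic.Quotient.mk_trans]
  simp only [Path.Homotopic.Quotient.mk_symm, Path.Homotopic.Quotient.mk_trans,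
    Path.Homotopic.Quotient.trans_assoc]
  rw [← Path.Homotopic.Quotient.trans_assoc (.mk p)]
  simp

theorem slitLoop_origin (i j : Fin 2) (hi : puncturedOrigin ∈ slitPlane i)
    (hj : puncturedOrigin ∈ slitPlane j) : slitLoop i j puncturedOrigin hi hj = 1 := by
  have h (k : Fin 2) (hk : puncturedOrigin ∈ slitPlane k) :
      Path.Homotopic.Quotient.mk (slitPath k (puncturedOrigin_mem_slitPlane k) hk) = .refl _ :=
    mk_eq_mk_of_mem_slitPlane (slitPath_mem _ _ _) (q := Path.refl _) fun _ ↦ hk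
  rw [slitLoop, h, h]
  exact Path.Homotopic.Quotient.trans_symm _

theorem slitLoop_eq_of_convex (i j : Fin 2) {x y : twicePuncturedPlane} {S : Set ℝ}
    (hS : Convex ℝ S) (hS₁ : ∀ s ∈ S, s ^ 2 ≠ 1) (hx : (x : ℂ).re ∈ S) (hy : (y : ℂ).re ∈ S)
    (hxi : x ∈ slitPlane i) (hxj : x ∈ slitPlane j) (hyi : y ∈ slitPlane i)
    (hyj : y ∈ slitPlane j) : slitLoop i j x hxi hxj = slitLoop i j y hyi hyj := by
  have hmem (t : I) : (AffineMap.lineMap (x : ℂ) (y : ℂ) (t : ℝ)).re ^ 2 ≠ 1 := by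
    apply hS₁
    have := hS.lineMap_mem hx hy t.2
    simpa [AffineMap.lineMap_apply] using this
  let p : Path x y :=
    ⟨⟨fun t ↦ ⟨AffineMap.lineMap (x : ℂ) (y : ℂ) (t : ℝ),
      mem_twicePuncturedPlane_of_re 0 fun h ↦ absurd h (hmem t)⟩, by
        refine Continuous.subtype_mk ?_ _
        simp only [AffineMap.lineMap_apply]
        fun_prop⟩, by ext; simp, by ext; simp⟩
  exact slitLoop_eq_of_path i j p (fun t ↦ mem_slitPlane_of_re (hmem t) i)
    (fun t ↦ mem_slitPlane_of_re (hmem t) j) _ _ _ _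

/-- The point `2` or `-2`, beyond one of the punctures on the real axis. -/
noncomputable def sidePoint (k : Fin 2) : twicePuncturedPlane :=
  ⟨((2 * slitSign k : ℝ) : ℂ), mem_twicePuncturedPlane_of_re 0 fun h ↦ by
    exfalso
    rw [Complex.ofReal_re, mul_pow, pow_two (slitSign k), slitSign_mul_self] at h
    norm_num at h⟩

theorem sidePoint_mem_slitPlane (k j : Fin 2) : sidePoint k ∈ slitPlane j := by
  refine mem_slitPlane_of_re (fun h ↦ ?_) j
  rw [sidePoint, Complex.ofReal_re, mul_pow, pow_two (slitSign k), slitSign_mul_self] at h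
  norm_num at h

/-- A loop at the origin winding once around the puncture `slitSign k`. -/
noncomputable def punctureLoop (k : Fin 2) : FundamentalGroup twicePuncturedPlane puncturedOrigin :=
  slitLoop k (Equiv.swap 0 1 k) (sidePoint k) (sidePoint_mem_slitPlane _ _)
    (sidePoint_mem_slitPlane _ _)

/-- The homomorphism sending the free generators to the loops around the punctures. -/
noncomputable def punctureHom :
    FreeGroup (Fin 2) →* FundamentalGroup twicePuncturedPlane puncturedOrigin :=
  FreeGroup.lift punctureLoop

theorem slitLoop_of_side {i : Fin 2} {x : twicePuncturedPlane}
    (hx : 1 < slitSign i * (x : ℂ).re) (hi : x ∈ slitPlane i)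
    (hj : x ∈ slitPlane (Equiv.swap 0 1 i)) :
    slitLoop i (Equiv.swap 0 1 i) x hi hj = punctureLoop i := by
  refine slitLoop_eq_of_convex i _ (S := {s | 1 < slitSign i * s}) ?_ ?_ hx ?_ _ _ _ _
  · exact convex_halfSpace_gt ⟨fun a b ↦ by ring, fun a b ↦ by simp; ring⟩ 1
  · intro s (hs : 1 < slitSign i * s) h
    nlinarith [slitSign_mul_self i]
  · have := slitSign_mul_self i
    simp only [sidePoint, Complex.ofReal_re, Set.mem_ofPred_eq]
    nlinarith

theorem punctureHom_surjective : Function.Surjective punctureHom := by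
  rw [← MonoidHom.range_eq_top]
  refine FundamentalGroup.eq_top_of_transition_mem isOpen_slitPlane exists_mem_slitPlane
    (fun i x hx ↦ .mk (slitPath i (puncturedOrigin_mem_slitPlane i) hx))
    (fun i x y hx hy p hp ↦ slitPath_trans _ _ _ _ hp) _ (puncturedOrigin_mem_slitPlane 0)
    (mk_eq_mk_of_mem_slitPlane (slitPath_mem _ _ _) (q := Path.refl _)
      fun _ ↦ puncturedOrigin_mem_slitPlane 0) fun i j x hi hj ↦ ?_
  change slitLoop i j x hi hj ∈ _
  have hmem (k : Fin 2) : punctureLoop k ∈ punctureHom.range :=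
    ⟨FreeGroup.of k, by simp [punctureHom]⟩
  by_cases hij : i = j
  · subst hij
    rw [slitLoop_self]
    exact one_mem _
  have hj' : j = Equiv.swap 0 1 i := by
    fin_cases i <;> fin_cases j <;> simp_all
  have hi' : i = Equiv.swap 0 1 j := by simp [hj']
  have hre := re_sq_ne_one_of_mem_slitPlane hij hi hj
  rcases hre.lt_or_gt with h | h
  · rw [slitLoop_eq_of_convex i j (S := Set.Ioo (-1) 1) (convex_Ioo _ _) _
      (abs_lt.1 ((sq_lt_one_iff_abs_lt_one _).1 h)) _ hi hj (puncturedOrigin_mem_slitPlane i)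
      (puncturedOrigin_mem_slitPlane j), slitLoop_origin]
    · exact one_mem _
    · rintro s ⟨h₁, h₂⟩ hs
      nlinarith
    · simp [puncturedOrigin]
  · have hside : 1 < slitSign i * (x : ℂ).re ∨ 1 < slitSign j * (x : ℂ).re := by
      rw [hj', slitSign_swap, neg_mul, ← lt_abs, abs_mul,
        show |slitSign i| = 1 by fin_cases i <;> simp [slitSign], one_mul]
      exact (one_lt_sq_iff_one_lt_abs _).1 h
    rcases hside with h | h
    · subst hj'
      rw [slitLoop_of_side h]
      exact hmem i
    · subst hi'
      rw [← slitLoop_inv, slitLoop_of_side h]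
      exact inv_mem (hmem j)

open Classical in
noncomputable def sideLabel (k : Fin 2) (x : twicePuncturedPlane) : FreeGroup (Fin 2) :=
  if 1 < slitSign k * (x : ℂ).re then FreeGroup.of k else 1

theorem sideLabel_eventually_eq (k : Fin 2) {x : twicePuncturedPlane} (hx : (x : ℂ).re ^ 2 ≠ 1) :
    ∀ᶠ y in nhds x, sideLabel k y = sideLabel k x := by
  have hne : slitSign k * (x : ℂ).re ≠ 1 := by
    intro h
    apply hx
    nlinarith [slitSign_mul_self k, congrArg (· ^ 2) h]
  have hcont : Continuous fun y : twicePuncturedPlane ↦ slitSign k * (y : ℂ).re := by fun_prop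
  rcases hne.lt_or_gt with h | h
  · filter_upwards [hcont.continuousAt.eventually_lt continuousAt_const h] with y hy
    simp [sideLabel, h.not_gt, hy.not_gt]
  · filter_upwards [continuousAt_const.eventually_lt hcont.continuousAt h] with y hy
    simp [sideLabel, h, hy]

theorem punctureHom_injective : Function.Injective punctureHom := by
  obtain ⟨Φ, hΦ⟩ := FundamentalGroup.exists_monodromy_of_cocycle isOpen_slitPlane
    exists_mem_slitPlane (fun i j x ↦ (sideLabel j x)⁻¹ * sideLabel i x)
    (fun i j x hi hj ↦ by
      by_cases hij : i = j
      · simp [hij]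
      have h := re_sq_ne_one_of_mem_slitPlane hij hi hj
      filter_upwards [sideLabel_eventually_eq i h, sideLabel_eventually_eq j h] with y h₁ h₂
      rw [h₁, h₂])
    (by simp) (fun i j k x ↦ by group) (x₀ := puncturedOrigin)
    (by simp [sideLabel, puncturedOrigin, (zero_lt_one' ℝ).not_gt])
  have key : Φ.comp punctureHom = MulAction.toPermHom (FreeGroup (Fin 2)) (FreeGroup (Fin 2)) := by
    refine FreeGroup.ext_hom _ _ fun k ↦ ?_
    have h := hΦ k (Equiv.swap 0 1 k) (sidePoint k) _ _
      (slitPath_mem k (puncturedOrigin_mem_slitPlane k) (sidePoint_mem_slitPlane k k))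
      (slitPath_mem (Equiv.swap 0 1 k) (puncturedOrigin_mem_slitPlane _)
        (sidePoint_mem_slitPlane k _))
    have hs := slitSign_mul_self k
    have e₁ : sideLabel k (sidePoint k) = FreeGroup.of k :=
      if_pos (by simp only [sidePoint, Complex.ofReal_re]; nlinarith)
    have e₂ : sideLabel (Equiv.swap 0 1 k) (sidePoint k) = 1 :=
      if_neg (by simp only [sidePoint, Complex.ofReal_re, slitSign_swap]; nlinarith)
    rw [e₁, e₂, inv_one, one_mul] at h
    simpa [punctureHom, punctureLoop, slitLoop] using h
  have hinj : Function.Injective (Φ.comp punctureHom) := by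
    rw [key]
    exact MulAction.toPerm_injective
  exact Function.Injective.of_comp (f := Φ) hinj

/-- The half turn `u ↦ -u`. -/
def punctureNeg : C(twicePuncturedPlane, twicePuncturedPlane) where
  toFun u := ⟨-u, fun h ↦ u.2 (by rwa [neg_sq] at h)⟩
  continuous_toFun := by fun_prop

theorem punctureNeg_origin : punctureNeg puncturedOrigin = puncturedOrigin := by
  ext
  simp [punctureNeg, puncturedOrigin]

theorem punctureNeg_mem_slitPlane {k : Fin 2} {u : twicePuncturedPlane} (hu : u ∈ slitPlane k) :
    punctureNeg u ∈ slitPlane (Equiv.swap 0 1 k) := by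
  intro h
  simpa [punctureNeg, slitSign_swap] using hu (by simpa [punctureNeg] using h)

theorem punctureNeg_sidePoint (k : Fin 2) :
    punctureNeg (sidePoint k) = sidePoint (Equiv.swap 0 1 k) := by
  ext
  simp [punctureNeg, sidePoint, slitSign_swap]

theorem mapOfEq_punctureNeg_punctureLoop (k : Fin 2) :
    FundamentalGroup.mapOfEq punctureNeg punctureNeg_origin (punctureLoop k) =
      punctureLoop (Equiv.swap 0 1 k) := by
  have h (j : Fin 2) (q : Path puncturedOrigin (sidePoint k)) (hq : ∀ t, q t ∈ slitPlane j)
      (q' : Path puncturedOrigin (sidePoint (Equiv.swap 0 1 k)))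
      (hq' : ∀ t, q' t ∈ slitPlane (Equiv.swap 0 1 j)) :
      Path.Homotopic.Quotient.mk ((q.map punctureNeg.continuous).cast punctureNeg_origin.symm
        (punctureNeg_sidePoint k).symm) = .mk q' :=
    mk_eq_mk_of_mem_slitPlane (fun t ↦ punctureNeg_mem_slitPlane (hq t)) hq'
  rw [FundamentalGroup.mapOfEq_apply, punctureLoop, punctureLoop, slitLoop, slitLoop,
    ← h k _ (slitPath_mem k (puncturedOrigin_mem_slitPlane k) (sidePoint_mem_slitPlane k k)) _
      (slitPath_mem _ _ _), ← h _ _ (slitPath_mem (Equiv.swap 0 1 k)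
        (puncturedOrigin_mem_slitPlane _) (sidePoint_mem_slitPlane k _)) _ (slitPath_mem _ _ _)]
  simp only [← Path.Homotopic.Quotient.mk_symm, ← Path.Homotopic.Quotient.mk_trans]
  refine congrArg Path.Homotopic.Quotient.mk (Path.ext (funext fun t ↦ ?_))
  simp only [Path.trans_apply, Path.cast_coe, Path.map_coe, Path.symm_apply, Function.comp_apply]
  split_ifs <;> rfl

theorem mapOfEq_punctureNeg_punctureHom (g : FreeGroup (Fin 2)) :
    FundamentalGroup.mapOfEq punctureNeg punctureNeg_origin (punctureHom g) =
      punctureHom (FreeGroup.freeGroupCongr (Equiv.swap 0 1) g) := by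
  refine DFunLike.congr_fun (f := (FundamentalGroup.mapOfEq punctureNeg punctureNeg_origin).comp
    punctureHom) (g := punctureHom.comp (FreeGroup.freeGroupCongr (Equiv.swap 0 1)).toMonoidHom)
    (FreeGroup.ext_hom _ _ fun k ↦ ?_) g
  simpa [punctureHom] using mapOfEq_punctureNeg_punctureLoop k

theorem FundamentalGroup.mul_mapOfEq_of_homotopy {Y Z : Type*} [TopologicalSpace Y]
    [TopologicalSpace Z] {f g : C(Y, Z)} (H : f.Homotopy g) {y : Y} {z : Z} (hf : f y = z)
    (hg : g y = z) (p : FundamentalGroup Y y) :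
    FundamentalGroup.fromPath (.mk ((H.evalAt y).cast hf.symm hg.symm)) *
      FundamentalGroup.mapOfEq f hf p = FundamentalGroup.mapOfEq g hg p *
      FundamentalGroup.fromPath (.mk ((H.evalAt y).cast hf.symm hg.symm)) := by
  obtain ⟨p, rfl⟩ := Path.Homotopic.Quotient.mk_surjective p
  rw [FundamentalGroup.mapOfEq_apply, FundamentalGroup.mapOfEq_apply, FundamentalGroup.mul_def,
    FundamentalGroup.mul_def]
  have h := congrArg (fun q ↦ Path.Homotopic.Quotient.cast q hf.symm hg.symm)
    (Path.Homotopic.Quotient.eq.2 (Path.Homotopic.map_trans_evalAt H p))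
  simp only [← Path.Homotopic.Quotient.mk_cast, ← Path.Homotopic.Quotient.mk_map,
    FundamentalGroup.fromPath, ← Path.Homotopic.Quotient.mk_trans] at h ⊢
  exact h

theorem map_mulAut_zpow_apply {N H : Type*} [Group N] [Group H] (A : N →* H) (s : MulAut N) (g : H)
    (h : ∀ x, A (s x) = g * A x * g⁻¹) (n : ℤ) (x : N) :
    A ((s ^ n) x) = g ^ n * A x * (g ^ n)⁻¹ := by
  induction n generalizing x with
  | zero => simp
  | succ n ih =>
    rw [zpow_add_one, MulAut.mul_apply, ih, h]
    group
  | pred n ih =>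
    have h' : A (s⁻¹ x) = g⁻¹ * A x * g := by
      have := h (s⁻¹ x)
      rw [MulAut.apply_inv_self] at this
      rw [this]
      group
    rw [zpow_sub_one, MulAut.mul_apply, ih, h']
    group

theorem FundamentalGroup.mem_range_mapOfEq_of_monodromy_eq {Y Z : Type*} [TopologicalSpace Y]
    [TopologicalSpace Z] {q : Y → Z} (cov : IsCoveringMap q) {y : Y} {z : Z} (hy : q y = z)
    {g : FundamentalGroup Z z} (h : cov.monodromy g ⟨y, hy⟩ = ⟨y, hy⟩) :
    ∃ p, FundamentalGroup.mapOfEq ⟨q, cov.continuous⟩ hy p = g := by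
  refine ⟨(cov.liftPathQuotient g ⟨y, hy⟩).cast rfl (congrArg Subtype.val h.symm), ?_⟩
  rw [FundamentalGroup.mapOfEq_apply, Path.Homotopic.Quotient.map_cast, cov.map_liftPathQuotient]
  exact (congrArg (Path.Homotopic.Quotient.cast · _ _)
    (Path.Homotopic.Quotient.cast_cast _ _ _ _ _)).trans
    ((Path.Homotopic.Quotient.cast_cast _ _ _ _ _).trans
    (Path.Homotopic.Quotient.cast_rfl_rfl g))

theorem FundamentalGroup.monodromy_mapOfEq {W Y Z : Type*} [TopologicalSpace W] [TopologicalSpace Y]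
    [TopologicalSpace Z] {q : Y → Z} (cov : IsCoveringMap q) {z : Z} (e : q ⁻¹' {z})
    {f : C(W, Z)} (F : C(W, Y)) (hF : ∀ w, q (F w) = f w) {w : W} (hw : F w = e)
    (hfw : f w = z) (p : FundamentalGroup W w) :
    cov.monodromy (FundamentalGroup.mapOfEq f hfw p) e = e := by
  obtain ⟨p, rfl⟩ := Path.Homotopic.Quotient.mk_surjective p
  rw [FundamentalGroup.mapOfEq_apply]
  exact cov.monodromy_eq_of_map_eq (.mk ((p.map F.continuous).cast hw.symm hw.symm))
    (congrArg Path.Homotopic.Quotient.mk (Path.ext (funext fun t ↦ hF (p t))))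

theorem FundamentalGroup.mapOfEq_injective_of_isCoveringMap {Y Z : Type*} [TopologicalSpace Y]
    [TopologicalSpace Z] {q : Y → Z} (cov : IsCoveringMap q) {z : Z} {y : Y} (hy : q y = z) :
    Function.Injective (FundamentalGroup.mapOfEq ⟨q, cov.continuous⟩ hy) := by
  subst hy
  intro a b h
  rw [FundamentalGroup.mapOfEq_apply, FundamentalGroup.mapOfEq_apply] at h
  exact cov.injective_path_homotopic_map _ _ ((Path.Homotopic.Quotient.cast_rfl_rfl _).symm.trans
    (h.trans (Path.Homotopic.Quotient.cast_rfl_rfl _)))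

theorem FundamentalGroup.mapOfEq_mapOfEq {W Y Z : Type*} [TopologicalSpace W] [TopologicalSpace Y]
    [TopologicalSpace Z] (f : C(W, Y)) (g : C(Y, Z)) {w : W} {y : Y} {z : Z} (hf : f w = y)
    (hg : g y = z) (hgf : (g.comp f) w = z) (p : FundamentalGroup W w) :
    FundamentalGroup.mapOfEq g hg (FundamentalGroup.mapOfEq f hf p) =
      FundamentalGroup.mapOfEq (g.comp f) hgf p := by
  subst hf
  subst hg
  obtain ⟨p, rfl⟩ := Path.Homotopic.Quotient.mk_surjective p
  simp only [FundamentalGroup.mapOfEq_apply]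
  rfl

theorem FundamentalGroup.mapOfEq_id {W : Type*} [TopologicalSpace W] {w : W}
    (h : ContinuousMap.id W w = w) (p : FundamentalGroup W w) :
    FundamentalGroup.mapOfEq (ContinuousMap.id W) h p = p := by
  obtain ⟨p, rfl⟩ := Path.Homotopic.Quotient.mk_surjective p
  rw [FundamentalGroup.mapOfEq_apply]
  rfl

noncomputable def expSnd (p : ℂ × ℂ) : ℂ × ℂ := (p.1, Complex.exp p.2)

theorem isCoveringMapOn_expSnd : IsCoveringMapOn expSnd {p | p.2 ≠ 0} := by
  have hopen : IsOpen {p : ℂ × ℂ | p.2 ≠ 0} := isOpen_ne_fun continuous_snd continuous_const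
  have hmaps (p : ℂ × ℂ) : expSnd p ∈ {p : ℂ × ℂ | p.2 ≠ 0} := Complex.exp_ne_zero _
  have hcont : Continuous expSnd :=
    continuous_fst.prodMk (Complex.continuous_exp.comp continuous_snd)
  refine .of_isCoveringMap_subtype hopen hmaps (IsAddQuotientCoveringMap.isCoveringMap _
    (AddSubgroup.zmultiples ((0, 2 * Real.pi * Complex.I) : ℂ × ℂ)) ?_)
  refine Topology.IsQuotientMap.isAddQuotientCoveringMap_of_addSubgroup ?_
    _ ⟨NormedSpace.discreteTopology_zmultiples _⟩ fun {p r} ↦ ?_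
  · refine IsOpenMap.isQuotientMap ?_ (hcont.subtype_mk _) fun p ↦
      ⟨(p.1.1, Complex.log p.1.2), Subtype.ext (Prod.ext rfl (Complex.exp_log p.2))⟩
    exact hopen.isOpenEmbedding_subtypeVal.isOpenMap_iff.2
      (IsOpenMap.id.prodMap Complex.isOpenMap_exp)
  · simp only [Subtype.ext_iff, expSnd, Prod.ext_iff, AddSubgroup.mem_zmultiples_iff]
    rw [eq_comm (a := Complex.exp _), Complex.exp_eq_exp_iff_exists_int, ← exists_and_left]
    refine exists_congr fun n ↦ and_congr ?_ ?_
    · simp [← sub_eq_add_neg, sub_eq_zero, eq_comm]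
    · rw [Prod.snd_add, Prod.snd_neg, ← sub_eq_add_neg, eq_sub_iff_add_eq', eq_comm]
      simp

abbrev parabolaCover : Set (ℂ × ℂ) := expSnd ⁻¹' parabolaComplement

noncomputable abbrev parabolaCoverProj : parabolaCover → parabolaComplement :=
  parabolaComplement.restrictPreimage expSnd

theorem isCoveringMap_parabolaCoverProj : IsCoveringMap parabolaCoverProj :=
  (isCoveringMapOn_expSnd.mono fun _ h ↦ h.1).isCoveringMap_restrictPreimage

theorem mem_parabolaCover {p : ℂ × ℂ} : p ∈ parabolaCover ↔ Complex.exp p.2 ≠ p.1 ^ 2 :=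
  ⟨fun h ↦ h.2, fun h ↦ ⟨Complex.exp_ne_zero _, h⟩⟩

/-- The points of the cover over the basepoint. -/
noncomputable def coverPoint (n : ℤ) : parabolaCoverProj ⁻¹' {parabolaBasepoint} :=
  ⟨⟨(0, n * (2 * Real.pi * Complex.I)), mem_parabolaCover.2 (by simp)⟩, by
    apply Subtype.ext
    simp [expSnd, parabolaBasepoint, Set.restrictPreimage, Complex.exp_int_mul_two_pi_mul_I]⟩

theorem exists_eq_coverPoint (e : parabolaCoverProj ⁻¹' {parabolaBasepoint}) :
    ∃ n, e = coverPoint n := by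
  obtain ⟨⟨⟨x, s⟩, hs⟩, he⟩ := e
  have he' : expSnd (x, s) = (0, 1) := congrArg Subtype.val he
  obtain ⟨rfl, hs'⟩ := Prod.ext_iff.1 he'
  obtain ⟨n, rfl⟩ := Complex.exp_eq_one_iff.1 hs'
  exact ⟨n, rfl⟩

theorem coverPoint_injective : Function.Injective coverPoint := by
  intro m n h
  have : (m : ℂ) * (2 * Real.pi * Complex.I) = n * (2 * Real.pi * Complex.I) :=
    congrArg (fun e : parabolaCoverProj ⁻¹' {parabolaBasepoint} ↦ e.1.1.2) h
  exact_mod_cast mul_right_cancel₀ Complex.two_pi_I_ne_zero this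

/-- The inclusion of the fiber of `parabolaComplement` over `y = 1`. -/
noncomputable def lineInclusion : C(twicePuncturedPlane, parabolaComplement) where
  toFun u := ⟨(u, 1), one_ne_zero, u.2.symm⟩
  continuous_toFun := by fun_prop

theorem lineInclusion_origin : lineInclusion puncturedOrigin = parabolaBasepoint := rfl

noncomputable def lineInclusionLift (n : ℤ) : C(twicePuncturedPlane, parabolaCover) where
  toFun u := ⟨(u, n * (2 * Real.pi * Complex.I)), mem_parabolaCover.2 (by
    rw [Complex.exp_int_mul_two_pi_mul_I]
    exact u.2.symm)⟩
  continuous_toFun := by fun_prop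

theorem parabolaCoverProj_lineInclusionLift (n : ℤ) (u : twicePuncturedPlane) :
    parabolaCoverProj (lineInclusionLift n u) = lineInclusion u :=
  Subtype.ext (Prod.ext rfl (Complex.exp_int_mul_two_pi_mul_I n))

/-- The homomorphism induced by the inclusion of the fiber. -/
noncomputable def lineHom : FundamentalGroup twicePuncturedPlane puncturedOrigin →*
    FundamentalGroup parabolaComplement parabolaBasepoint :=
  FundamentalGroup.mapOfEq lineInclusion lineInclusion_origin

noncomputable def lineRetraction : C(parabolaCover, twicePuncturedPlane) where
  toFun p := ⟨p.1.1 * Complex.exp (-(p.1.2 / 2)), fun h ↦ by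
    apply mem_parabolaCover.1 p.2
    have : Complex.exp (-(p.1.2 / 2)) ^ 2 * Complex.exp p.1.2 = 1 := by
      rw [← Complex.exp_nat_mul, ← Complex.exp_add]
      simp
      ring_nf
      simp
    linear_combination p.1.1 ^ 2 * this - Complex.exp p.1.2 * h⟩
  continuous_toFun := by fun_prop

theorem lineRetraction_coverPoint (n : ℤ) : lineRetraction (coverPoint n).1 = puncturedOrigin := by
  ext
  simp [lineRetraction, coverPoint, puncturedOrigin]

theorem lineHom_injective : Function.Injective lineHom := by
  have hinj := FundamentalGroup.mapOfEq_injective_of_isCoveringMap isCoveringMap_parabolaCoverProj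
    (coverPoint 0).2
  have hcomp : lineRetraction.comp (lineInclusionLift 0) = ContinuousMap.id _ := by
    ext u
    simp [lineRetraction, lineInclusionLift]
  have hcomp' : (⟨parabolaCoverProj, isCoveringMap_parabolaCoverProj.continuous⟩ :
      C(parabolaCover, parabolaComplement)).comp (lineInclusionLift 0) = lineInclusion :=
    ContinuousMap.ext (parabolaCoverProj_lineInclusionLift 0)
  have hlift : lineInclusionLift 0 puncturedOrigin = (coverPoint 0).1 := rfl
  intro a b h
  have h₁ (p) := FundamentalGroup.mapOfEq_mapOfEq (lineInclusionLift 0)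
    ⟨parabolaCoverProj, isCoveringMap_parabolaCoverProj.continuous⟩ hlift (coverPoint 0).2
    (hcomp' ▸ lineInclusion_origin) p
  have h₂ (p) := FundamentalGroup.mapOfEq_mapOfEq (lineInclusionLift 0) lineRetraction hlift
    (lineRetraction_coverPoint 0) (by rw [hcomp]; rfl) p
  simp only [hcomp'] at h₁
  simp only [hcomp, FundamentalGroup.mapOfEq_id] at h₂
  rw [← h₂ a, ← h₂ b, hinj ((h₁ a).trans (h.trans (h₁ b).symm))]

theorem exp_mul_ne_of_ne {x s : ℂ} (h : Complex.exp s ≠ x ^ 2) (r : ℂ) :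
    Complex.exp (s * (1 - r)) ≠ (x * Complex.exp (-(s * r / 2))) ^ 2 := by
  intro h'
  apply h
  have e₁ : Complex.exp (-(s * r / 2)) ^ 2 * Complex.exp (s * r) = 1 := by
    rw [← Complex.exp_nat_mul, ← Complex.exp_add]
    simp
    ring_nf
    simp
  have e₂ : Complex.exp (s * (1 - r)) * Complex.exp (s * r) = Complex.exp s := by
    rw [← Complex.exp_add]
    ring_nf
  linear_combination x ^ 2 * e₁ - e₂ + Complex.exp (s * r) * h'

noncomputable def lineRetractionHomotopy :
    (⟨parabolaCoverProj, isCoveringMap_parabolaCoverProj.continuous⟩ :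
      C(parabolaCover, parabolaComplement)).Homotopy (lineInclusion.comp lineRetraction) where
  toFun p := ⟨(p.2.1.1 * Complex.exp (-(p.2.1.2 * (p.1 : ℝ) / 2)),
    Complex.exp (p.2.1.2 * (1 - (p.1 : ℝ)))), Complex.exp_ne_zero _,
    exp_mul_ne_of_ne (mem_parabolaCover.1 p.2.2) _⟩
  continuous_toFun := by fun_prop
  map_zero_left p := by
    apply Subtype.ext
    simp [expSnd]
  map_one_left p := by
    apply Subtype.ext
    simp [lineInclusion, lineRetraction]

theorem mem_range_lineHom {g : FundamentalGroup parabolaComplement parabolaBasepoint}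
    (h : isCoveringMap_parabolaCoverProj.monodromy g (coverPoint 0) = coverPoint 0) :
    g ∈ lineHom.range := by
  obtain ⟨p, rfl⟩ := FundamentalGroup.mem_range_mapOfEq_of_monodromy_eq _ (coverPoint 0).2 h
  have hbase : (lineInclusion.comp lineRetraction) (coverPoint 0).1 = parabolaBasepoint := by
    rw [ContinuousMap.comp_apply, lineRetraction_coverPoint, lineInclusion_origin]
  have key := FundamentalGroup.mul_mapOfEq_of_homotopy lineRetractionHomotopy (coverPoint 0).2
    hbase p
  have hconst : (lineRetractionHomotopy.evalAt (coverPoint 0).1).cast (coverPoint 0).2.symm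
      hbase.symm = Path.refl parabolaBasepoint := by
    refine Path.ext (funext fun t ↦ Subtype.ext ?_)
    change ((0 : ℂ) * Complex.exp _, Complex.exp (((0 : ℤ) * (2 * Real.pi * Complex.I)) *
      (1 - (t : ℝ)))) = (0, 1)
    simp
  rw [hconst] at key
  refine ⟨FundamentalGroup.mapOfEq lineRetraction (lineRetraction_coverPoint 0) p, ?_⟩
  rw [lineHom, FundamentalGroup.mapOfEq_mapOfEq _ _ _ _ hbase]
  have hone : FundamentalGroup.fromPath
      (Path.Homotopic.Quotient.mk (Path.refl parabolaBasepoint)) = 1 := rfl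
  rw [hone, one_mul, mul_one] at key
  exact key.symm

/-- Parallel transport of the fiber once around `y = 0`, which ends in the half turn. -/
noncomputable def meridianHomotopy :
    lineInclusion.Homotopy (lineInclusion.comp punctureNeg) where
  toFun p := ⟨(Complex.exp (Real.pi * Complex.I * (p.1 : ℝ)) * p.2,
    Complex.exp (2 * Real.pi * Complex.I * (p.1 : ℝ))), Complex.exp_ne_zero _, fun h ↦ by
      apply p.2.2
      have e : Complex.exp (2 * Real.pi * Complex.I * (p.1 : ℝ)) =
          Complex.exp (Real.pi * Complex.I * (p.1 : ℝ)) ^ 2 := by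
        rw [← Complex.exp_nat_mul]
        push_cast
        ring_nf
      refine mul_left_cancel₀ (Complex.exp_ne_zero (2 * Real.pi * Complex.I * (p.1 : ℝ))) ?_
      have h' : Complex.exp (2 * Real.pi * Complex.I * (p.1 : ℝ)) =
          (Complex.exp (Real.pi * Complex.I * (p.1 : ℝ)) * p.2) ^ 2 := h
      linear_combination (p.2 : ℂ) ^ 2 * e - h'⟩
  continuous_toFun := by fun_prop
  map_zero_left p := by
    apply Subtype.ext
    simp [lineInclusion]
  map_one_left p := by
    apply Subtype.ext
    simp [lineInclusion, punctureNeg]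

theorem lineInclusion_punctureNeg_origin :
    (lineInclusion.comp punctureNeg) puncturedOrigin = parabolaBasepoint := by
  rw [ContinuousMap.comp_apply, punctureNeg_origin, lineInclusion_origin]

/-- The loop around `y = 0` traced by the basepoint. -/
noncomputable def meridian : FundamentalGroup parabolaComplement parabolaBasepoint :=
  FundamentalGroup.fromPath (.mk ((meridianHomotopy.evalAt puncturedOrigin).cast
    lineInclusion_origin.symm lineInclusion_punctureNeg_origin.symm))

theorem lineHom_punctureHom_swapGenerators (f : FreeGroup (Fin 2)) :
    lineHom.comp punctureHom (swapGenerators f) =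
      meridian * lineHom.comp punctureHom f * meridian⁻¹ := by
  have h := FundamentalGroup.mul_mapOfEq_of_homotopy meridianHomotopy lineInclusion_origin
    lineInclusion_punctureNeg_origin (punctureHom f)
  rw [← FundamentalGroup.mapOfEq_mapOfEq punctureNeg lineInclusion punctureNeg_origin
    lineInclusion_origin, mapOfEq_punctureNeg_punctureHom] at h
  exact eq_mul_inv_of_mul_eq h.symm

theorem monodromyPerm_meridian_coverPoint (n : ℤ) :
    isCoveringMap_parabolaCoverProj.monodromyPerm _ meridian (coverPoint n) =
      coverPoint (n + 1) := by
  rw [IsCoveringMap.coe_monodromyPerm]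
  let p : Path (coverPoint n).1 (coverPoint (n + 1)).1 :=
    ⟨⟨fun t ↦ ⟨(0, (n + (t : ℝ)) * (2 * Real.pi * Complex.I)), mem_parabolaCover.2 (by simp)⟩,
      by fun_prop⟩, by
        apply Subtype.ext
        simp [coverPoint], by
        apply Subtype.ext
        simp [coverPoint]⟩
  refine isCoveringMap_parabolaCoverProj.monodromy_eq_of_map_eq (.mk p)
    (congrArg Path.Homotopic.Quotient.mk (Path.ext (funext fun t ↦ Subtype.ext ?_)))
  have h : Complex.exp ((n + ((t : ℝ) : ℂ)) * (2 * Real.pi * Complex.I)) =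
      Complex.exp (2 * Real.pi * Complex.I * (t : ℝ)) := by
    rw [add_mul, Complex.exp_add, Complex.exp_int_mul_two_pi_mul_I, one_mul, mul_comm]
  refine Prod.ext ?_ h
  change (0 : ℂ) = Complex.exp _ * 0
  simp

theorem monodromyPerm_meridian_zpow_coverPoint (n m : ℤ) :
    isCoveringMap_parabolaCoverProj.monodromyPerm _ (meridian ^ n) (coverPoint m) =
      coverPoint (n + m) := by
  rw [map_zpow]
  induction n generalizing m with
  | zero => simp
  | succ n ih =>
    rw [zpow_add_one, Equiv.Perm.mul_apply, monodromyPerm_meridian_coverPoint, ih]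
    ring_nf
  | pred n ih =>
    have h : (isCoveringMap_parabolaCoverProj.monodromyPerm _ meridian)⁻¹ (coverPoint m) =
        coverPoint (m - 1) := by
      rw [Equiv.Perm.inv_eq_iff_eq, monodromyPerm_meridian_coverPoint, sub_add_cancel]
    rw [zpow_sub_one, Equiv.Perm.mul_apply, h, ih]
    ring_nf

theorem monodromyPerm_lineHom_coverPoint
    (g : FundamentalGroup twicePuncturedPlane puncturedOrigin) (n : ℤ) :
    isCoveringMap_parabolaCoverProj.monodromyPerm _ (lineHom g) (coverPoint n) = coverPoint n :=
  FundamentalGroup.monodromy_mapOfEq isCoveringMap_parabolaCoverProj (coverPoint n)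
    (lineInclusionLift n) (parabolaCoverProj_lineInclusionLift n) rfl lineInclusion_origin g

/-- The homomorphism from the semidirect product that is `lineHom ∘ punctureHom` on the free group
and sends the generator of `ℤ` to `meridian`. -/
noncomputable def semidirectHom : FreeGroup (Fin 2) ⋊[exchangeAction] Multiplicative ℤ →*
    FundamentalGroup parabolaComplement parabolaBasepoint :=
  SemidirectProduct.lift (lineHom.comp punctureHom) (zpowersHom _ meridian) fun n ↦
    MonoidHom.ext fun f ↦ map_mulAut_zpow_apply (lineHom.comp punctureHom) swapGenerators meridian
      lineHom_punctureHom_swapGenerators n.toAdd f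

theorem semidirectHom_apply (x : FreeGroup (Fin 2) ⋊[exchangeAction] Multiplicative ℤ) :
    semidirectHom x = lineHom (punctureHom x.left) * meridian ^ x.right.toAdd := rfl

theorem semidirectHom_injective : Function.Injective semidirectHom := by
  rw [injective_iff_map_eq_one]
  intro x hx
  rw [semidirectHom_apply] at hx
  have hn : x.right.toAdd = 0 := by
    have h := congrArg (fun g ↦ isCoveringMap_parabolaCoverProj.monodromyPerm _ g (coverPoint 0)) hx
    simp only [map_mul, Equiv.Perm.mul_apply, monodromyPerm_meridian_zpow_coverPoint,
      monodromyPerm_lineHom_coverPoint, map_one, Equiv.Perm.one_apply, add_zero] at h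
    exact coverPoint_injective h
  rw [hn, zpow_zero, mul_one] at hx
  refine SemidirectProduct.ext ?_ (Multiplicative.toAdd.injective hn)
  exact (injective_iff_map_eq_one (lineHom.comp punctureHom)).1
    (lineHom_injective.comp punctureHom_injective) _ hx

theorem semidirectHom_surjective : Function.Surjective semidirectHom := by
  intro g
  obtain ⟨n, hn⟩ :=
    exists_eq_coverPoint (isCoveringMap_parabolaCoverProj.monodromyPerm _ g (coverPoint 0))
  have h : isCoveringMap_parabolaCoverProj.monodromyPerm _ (meridian ^ (-n) * g) (coverPoint 0) =
      coverPoint 0 := by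
    rw [map_mul, Equiv.Perm.mul_apply, hn, monodromyPerm_meridian_zpow_coverPoint, neg_add_cancel]
  obtain ⟨p, hp⟩ := mem_range_lineHom h
  obtain ⟨f, rfl⟩ := punctureHom_surjective p
  refine ⟨.inr (Multiplicative.ofAdd n) * .inl f, ?_⟩
  have hl : semidirectHom (.inl f) = lineHom (punctureHom f) := SemidirectProduct.lift_inl _ _ _ f
  have hr : semidirectHom (.inr (Multiplicative.ofAdd n)) = meridian ^ n :=
    SemidirectProduct.lift_inr _ _ _ _
  rw [map_mul, hl, hr, hp, zpow_neg, mul_inv_cancel_left]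

/-- The fundamental group of the complement of a line and a tangent parabola in `ℂ²`
is the semidirect product `F₂ ⋊ ℤ`, with `ℤ` acting by exchanging the generators. -/
theorem fundamental_group_tangential_intersection :
    Nonempty (FundamentalGroup parabolaComplement parabolaBasepoint ≃*
      FreeGroup (Fin 2) ⋊[exchangeAction] Multiplicative ℤ) :=
  ⟨(MulEquiv.ofBijective semidirectHom ⟨semidirectHom_injective, semidirectHom_surjective⟩).symm⟩
end

section
/- For all nonzero real x and y, the triple (α₁, α₂, α₄) = ((1 − x²y²)·x, (x² − y²)·x, (x⁴ − 1)·y) satisfies the two equations α₁·x − α₂·x⁻¹ + α₄·y = 0 and α₁·x⁻¹ − α₂·x + α₄·y⁻¹ = 0. Moreover, if x > 1, y > 0 and x·y < 1, then all three components α₁, α₂, α₄ are strictly positive. -/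
/-- The projective solution `(α₁, α₂, α₄) = ((1−x²y²)x, (x²−y²)x, (x⁴−1)y)` of the
Landau loop equations of the ice cream cone along its parametrized Pham locus, and
its α-positivity in the region `x > 1`, `y > 0`, `x·y < 1`. -/
theorem icecream_cone_alpha_solution (x y : ℝ) (hx : x ≠ 0) (hy : y ≠ 0) :
    ((1 - x ^ 2 * y ^ 2) * x * x - (x ^ 2 - y ^ 2) * x * x⁻¹ + (x ^ 4 - 1) * y * y = 0 ∧
      (1 - x ^ 2 * y ^ 2) * x * x⁻¹ - (x ^ 2 - y ^ 2) * x * x + (x ^ 4 - 1) * y * y⁻¹ = 0) ∧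
    (1 < x → 0 < y → x * y < 1 →
      0 < (1 - x ^ 2 * y ^ 2) * x ∧ 0 < (x ^ 2 - y ^ 2) * x ∧ 0 < (x ^ 4 - 1) * y) := by
  refine ⟨⟨by field_simp; ring, by field_simp; ring⟩, fun hx1 hy0 hxy => ?_⟩
  have hx0 : 0 < x := one_pos.trans hx1
  have hyx : y < x := by nlinarith
  have h1 : x ^ 2 * y ^ 2 < 1 := by
    rw [← mul_pow]
    exact pow_lt_one₀ (by positivity) hxy two_ne_zero
  have h2 : y ^ 2 < x ^ 2 := pow_lt_pow_left₀ hyx hy0.le two_ne_zero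
  have h4 : 1 < x ^ 4 := one_lt_pow₀ hx1 four_ne_zero
  exact ⟨mul_pos (sub_pos.2 h1) hx0, mul_pos (sub_pos.2 h2) hx0, mul_pos (sub_pos.2 h4) hy0⟩
end

section
/- Let m > 0 and let G(s,t) be the 4×4 real symmetric matrix [[4m², −4m², (5m²−t)/2, 2m²], [−4m², 4m², 2m², (5m²−s)/2], [(5m²−t)/2, 2m², m², −m²], [2m², (5m²−s)/2, −m², m²]]. At s = t = 9m², G equals the outer product v·vᵀ with v = (2m, −2m, −m, m); in particular G has rank 1 there, so det G = 0 and every 3×3 minor of G vanishes at s = t = 9m². -/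
/-- At `s = t = 9m²` the Gram matrix of the internal momenta of the special-mass box
degenerates to the rank-one outer product `v·vᵀ` with `v = (2m,−2m,−m,m)`; hence its
determinant and all its 3×3 minors vanish there. -/
theorem box_gram_matrix_rank_one (m : ℝ) (hm : 0 < m)
    (G : ℝ → ℝ → Matrix (Fin 4) (Fin 4) ℝ)
    (hG : ∀ s t : ℝ, G s t =
      !![4 * m ^ 2, -4 * m ^ 2, (5 * m ^ 2 - t) / 2, 2 * m ^ 2;
         -4 * m ^ 2, 4 * m ^ 2, 2 * m ^ 2, (5 * m ^ 2 - s) / 2;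
         (5 * m ^ 2 - t) / 2, 2 * m ^ 2, m ^ 2, -m ^ 2;
         2 * m ^ 2, (5 * m ^ 2 - s) / 2, -m ^ 2, m ^ 2])
    (v : Fin 4 → ℝ) (hv : v = ![2 * m, -2 * m, -m, m]) :
    G (9 * m ^ 2) (9 * m ^ 2) = Matrix.of (fun i j => v i * v j) ∧
    (G (9 * m ^ 2) (9 * m ^ 2)).rank = 1 ∧
    (G (9 * m ^ 2) (9 * m ^ 2)).det = 0 ∧
    (∀ i j : Fin 4,
      ((G (9 * m ^ 2) (9 * m ^ 2)).submatrix i.succAbove j.succAbove).det = 0) := by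
  have hGv : G (9 * m ^ 2) (9 * m ^ 2) = Matrix.vecMulVec v v := by
    rw [hG, hv]
    ext i j
    fin_cases i <;> fin_cases j <;> simp [Matrix.vecMulVec_apply] <;> ring
  have hv0 : v ≠ 0 := by
    intro h
    have h3 : v 3 = 0 := congrFun h 3
    rw [hv] at h3
    exact hm.ne' h3
  rw [hGv]
  refine ⟨rfl, ?_, Matrix.det_vecMulVec v v, fun i j => ?_⟩
  · refine le_antisymm (Matrix.rank_vecMulVec_le v v) (Nat.one_le_iff_ne_zero.mpr fun h => ?_)
    rw [Matrix.rank, Submodule.finrank_eq_zero, LinearMap.range_eq_bot] at h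
    exact Matrix.vecMulVec_ne_zero hv0 hv0
      (Matrix.toLin'.injective ((Matrix.toLin'_apply' _).trans (h.trans (map_zero _).symm)))
  · exact Matrix.det_vecMulVec (v ∘ i.succAbove) (v ∘ j.succAbove)
end
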